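/- arXiv:2411.17153 — 2 statements merged into one kernel-verified Lean document; each statement's English description precedes it below -/
import Mathlib

section
/- Hardy-type embedding of weighted Sobolev spaces: Let Ω ⊂ ℝ^d be a bounded domain with C^{1+ε_*} boundary and r a non-degenerate defining function of Ω. Suppose s₁ > s₂ ≥ 0 are integers, λ₁ > λ₂ > −1/2, and s₁ − λ₁ = s₂ − λ₂. Then there exists a constant C such that ‖f‖_{H^{s₂,λ₂}_r(Ω)} ≤ C ‖f‖_{H^{s₁,λ₁}_r(Ω)} for all f with finite right-hand side; that is, H^{s₁,λ₁}_r(Ω) embeds continuously into H^{s₂,λ₂}_r(Ω). -/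
open MeasureTheory Set

noncomputable section

/-- `d`-dimensional Euclidean space. -/
abbrev Euc (d : ℕ) : Type := EuclideanSpace ℝ (Fin d)

variable {d : ℕ}

/-- `r` is a non-degenerate defining function of the bounded domain `Ω` with `C^{1+ε}`
boundary: `r ≥ 0`, `Ω = {r > 0}`, `r ∈ C^{1+ε}(Ω̄)` and `|∇r| > 0` on `∂Ω`. -/
def IsDefiningFunction (ε : ℝ) (Ω : Set (Euc d)) (r : Euc d → ℝ) : Prop :=
  IsOpen Ω ∧ Ω.Nonempty ∧ Bornology.IsBounded Ω ∧
  (∀ x, 0 ≤ r x) ∧ Ω = {x | 0 < r x} ∧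
  ContDiffOn ℝ 1 r (closure Ω) ∧
  (∃ K : ℝ, ∀ x ∈ closure Ω, ∀ y ∈ closure Ω,
    ‖fderivWithin ℝ r (closure Ω) x - fderivWithin ℝ r (closure Ω) y‖ ≤ K * dist x y ^ ε) ∧
  (∀ x ∈ frontier Ω, fderivWithin ℝ r (closure Ω) x ≠ 0)

/-- Squared weighted Sobolev norm `‖f‖²_{H^{j,λ}_r(Ω)} = Σ_{i≤j} ∫_Ω |r^λ ∂^i f|² dx`. -/
def sobNormSq {F : Type*} [NormedAddCommGroup F] [NormedSpace ℝ F]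
    (r : Euc d → ℝ) (Ω : Set (Euc d)) (j : ℕ) (lam : ℝ) (f : Euc d → F) : ℝ :=
  ∑ i ∈ Finset.range (j + 1), ∫ x in Ω, ((r x) ^ lam * ‖iteratedFDeriv ℝ i f x‖) ^ 2

lemma geom_boundary {ε : ℝ} {Ω : Set (Euc d)} {r : Euc d → ℝ} (hr : IsDefiningFunction ε Ω r)
    {x0 : Euc d} (hx0 : x0 ∈ frontier Ω) :
    ∃ (v : Euc d) (c τ δ : ℝ), 0 < c ∧ 0 < τ ∧ 0 < δ ∧
      ∀ y ∈ Ω, dist y x0 < δ → ∀ s ∈ Icc 0 τ, y + s • v ∈ Ω ∧ r y + c * s ≤ r (y + s • v) := by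
  obtain ⟨ho, -, -, hnn, hΩ, hC, -, hfr⟩ := hr
  have hpos : ∀ y, y ∈ Ω ↔ 0 < r y := fun y => by
    constructor
    · intro h; rw [hΩ] at h; exact h
    · intro h; rw [hΩ]; exact h
  have hx0c : x0 ∈ closure Ω := frontier_subset_closure hx0
  have h1 := hC x0 hx0c
  rw [show (1 : WithTop ℕ∞) = 0 + 1 by simp,
    contDiffWithinAt_succ_iff_hasFDerivWithinAt (by simp)] at h1
  obtain ⟨u, hu, -, f', hf', hf'c⟩ := h1
  rw [insert_eq_of_mem hx0c] at hu
  have hx0u : x0 ∈ u := mem_of_mem_nhdsWithin hx0c hu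
  have hL : HasFDerivWithinAt r (f' x0) (closure Ω) x0 :=
    (hf' x0 hx0u).mono_of_mem_nhdsWithin hu
  have hL0 : f' x0 ≠ 0 := by
    intro h
    rw [h] at hL
    apply hfr x0 hx0
    rw [fderivWithin_def, if_pos hL]
  obtain ⟨v0, hv0⟩ : ∃ v0, f' x0 v0 ≠ 0 := by
    by_contra! h
    exact hL0 (ContinuousLinearMap.ext h)
  set v : Euc d := (f' x0 v0)⁻¹ • v0 with hv
  have hv1 : f' x0 v = 1 := by simp [hv, hv0]
  have hcont : ContinuousWithinAt f' u x0 := hf'c.continuousWithinAt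
  have hcv : ContinuousWithinAt (fun y => f' y v) u x0 :=
    hcont.clm_apply continuousWithinAt_const
  have hev : ∀ᶠ y in nhdsWithin x0 u, 1 / 2 < f' y v := by
    apply hcv.eventually_const_lt
    change 1 / 2 < f' x0 v
    rw [hv1]; norm_num
  have hev2 : ∀ᶠ y in nhdsWithin x0 (closure Ω), 1 / 2 < f' y v := by
    exact (nhdsWithin_le_of_mem hu) hev
  have hev3 : ∀ᶠ y in nhdsWithin x0 (closure Ω), y ∈ u ∧ 1 / 2 < f' y v :=
    Filter.Eventually.and hu hev2
  obtain ⟨δ0, hδ0, hball⟩ := Metric.mem_nhdsWithin_iff.mp hev3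
  have hder : ∀ y ∈ Ω, dist y x0 < δ0 → HasFDerivAt r (f' y) y ∧ 1 / 2 < f' y v := by
    intro y hy hd
    have hm := hball ⟨Metric.mem_ball.mpr hd, subset_closure hy⟩
    refine ⟨(hf' y hm.1).hasFDerivAt ?_, hm.2⟩
    filter_upwards [ho.mem_nhds hy, Metric.isOpen_ball.mem_nhds (Metric.mem_ball.mpr hd)]
      with z hz hz2
    exact (hball ⟨hz2, subset_closure hz⟩).1
  set τ : ℝ := δ0 / 2 / (‖v‖ + 1) with hτ
  have hτ0 : 0 < τ := by positivity
  have hnear : ∀ y, dist y x0 < δ0 / 2 → ∀ s ∈ Icc 0 τ, dist (y + s • v) x0 < δ0 := by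
    intro y hy s hs
    have h2 : ‖s • v‖ ≤ δ0 / 2 := by
      rw [norm_smul, Real.norm_of_nonneg hs.1]
      calc s * ‖v‖ ≤ τ * (‖v‖ + 1) := by
            apply mul_le_mul hs.2 (by linarith) (norm_nonneg _) hτ0.le
        _ = δ0 / 2 := by rw [hτ]; field_simp
    calc dist (y + s • v) x0 ≤ dist (y + s • v) y + dist y x0 := dist_triangle _ _ _
      _ = ‖s • v‖ + dist y x0 := by simp [dist_eq_norm]
      _ < δ0 := by linarith
  have hgrow : ∀ y ∈ Ω, dist y x0 < δ0 / 2 → ∀ s ∈ Icc 0 τ, (∀ t ∈ Ico 0 s, y + t • v ∈ Ω) →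
      r y + 1 / 2 * s ≤ r (y + s • v) := by
    intro y hy hd s hs hseg
    have hcl : ∀ t ∈ Icc 0 s, y + t • v ∈ closure Ω := by
      intro t ht
      rcases eq_or_lt_of_le hs.1 with h0 | h0
      · have : t = 0 := le_antisymm (by rw [h0]; exact ht.2) ht.1
        simpa [this] using subset_closure hy
      · have hmt : MapsTo (fun t : ℝ => y + t • v) (Ico 0 s) Ω := hseg
        have hc : Continuous (fun t : ℝ => y + t • v) := by fun_prop
        have := hmt.closure hc
        rw [closure_Ico h0.ne] at this
        exact this ht
    have hda : ∀ t ∈ Ioo 0 s, HasDerivAt (fun t : ℝ => r (y + t • v)) (f' (y + t • v) v) t := by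
      intro t ht
      have h3 := (hder (y + t • v) (hseg t ⟨ht.1.le, ht.2⟩)
        (hnear y hd t ⟨ht.1.le, ht.2.le.trans hs.2⟩)).1
      have h4 : HasDerivAt (fun t : ℝ => y + t • v) v t := by
        simpa using ((hasDerivAt_id t).smul_const v).const_add y
      exact h3.comp_hasDerivAt t h4
    have := Convex.mul_sub_le_image_sub_of_le_deriv (D := Icc 0 s) (convex_Icc 0 s)
      (f := fun t : ℝ => r (y + t • v))
      (hC.continuousOn.comp (by fun_prop) hcl)
      (by rw [interior_Icc]; exact fun t ht => (hda t ht).differentiableAt.differentiableWithinAt)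
      (C := 1 / 2)
      (by
        rw [interior_Icc]
        intro t ht
        rw [(hda t ht).deriv]
        exact ((hder (y + t • v) (hseg t ⟨ht.1.le, ht.2⟩)
          (hnear y hd t ⟨ht.1.le, ht.2.le.trans hs.2⟩)).2).le)
      0 ⟨le_rfl, hs.1⟩ s ⟨hs.1, le_rfl⟩ hs.1
    simp at this
    linarith
  have hin : ∀ y ∈ Ω, dist y x0 < δ0 / 2 → ∀ s ∈ Icc 0 τ, y + s • v ∈ Ω := by
    intro y hy hd s hs
    by_contra hns
    set T : Set ℝ := Icc 0 s ∩ (fun t : ℝ => y + t • v) ⁻¹' Ωᶜ with hT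
    have hTc : IsClosed T := isClosed_Icc.inter (ho.isClosed_compl.preimage (by fun_prop))
    have hTn : T.Nonempty := ⟨s, ⟨hs.1, le_rfl⟩, hns⟩
    have hTb : BddBelow T := ⟨0, fun t ht => ht.1.1⟩
    have hm := hTc.csInf_mem hTn hTb
    set s1 := sInf T
    have h5 := hgrow y hy hd s1 ⟨hm.1.1, hm.1.2.trans hs.2⟩ (by
      intro t ht
      by_contra hn
      have : s1 ≤ t := csInf_le hTb ⟨⟨ht.1, ht.2.le.trans hm.1.2⟩, hn⟩
      linarith [ht.2])
    apply hm.2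
    rw [hpos]
    have := (hpos y).1 hy
    have := hm.1.1
    linarith
  refine ⟨v, 1 / 2, τ, δ0 / 2, by norm_num, hτ0, by positivity, ?_⟩
  intro y hy hd s hs
  exact ⟨hin y hy hd s hs, hgrow y hy hd s hs
    (fun t ht => hin y hy hd t ⟨ht.1, ht.2.le.trans hs.2⟩)⟩

/-- `∫ (r₀ + c s)^{-b}` bound. -/
lemma oneD_B {r0 c b τ : ℝ} (hr0 : 0 < r0) (hc : 0 < c) (hb : 1 < b) (hτ : 0 < τ) :
    ∫⁻ s in Ioo 0 τ, ENNReal.ofReal ((r0 + c * s) ^ (-b)) ≤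
      ENNReal.ofReal (1 / (c * (b - 1)) * r0 ^ (1 - b)) := by
  have hp : ∀ s ∈ Icc 0 τ, 0 < r0 + c * s := fun s hs => by
    have := mul_nonneg hc.le hs.1
    linarith
  have hco : ContinuousOn (fun s : ℝ => (r0 + c * s) ^ (-b)) (Icc 0 τ) := by
    apply ContinuousOn.rpow_const (by fun_prop)
    intro s hs; left; exact (hp s hs).ne'
  have hint : IntervalIntegrable (fun s : ℝ => (r0 + c * s) ^ (-b)) volume 0 τ := by
    apply ContinuousOn.intervalIntegrable
    rwa [uIcc_of_le hτ.le]
  have hI := intervalIntegral.integral_eq_sub_of_hasDerivAt (a := 0) (b := τ)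
    (f := fun s : ℝ => -(1 / (c * (b - 1))) * (r0 + c * s) ^ (1 - b))
    (f' := fun s : ℝ => (r0 + c * s) ^ (-b)) (by
      intro s hs
      rw [uIcc_of_le hτ.le] at hs
      have h1 : HasDerivAt (fun s : ℝ => r0 + c * s) c s := by
        simpa using ((hasDerivAt_id s).const_mul c).const_add r0
      have h2 := (h1.rpow_const (p := 1 - b) (Or.inl (hp s hs).ne')).const_mul
        (-(1 / (c * (b - 1))))
      refine h2.congr_deriv ?_
      rw [show 1 - b - 1 = -b by ring]
      have : b - 1 ≠ 0 := by linarith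
      field_simp
      ring) hint
  rw [restrict_Ioo_eq_restrict_Ioc, ← ofReal_integral_eq_lintegral_ofReal]
  · rw [← intervalIntegral.integral_of_le hτ.le, hI]
    apply ENNReal.ofReal_le_ofReal
    have h3 : 0 ≤ 1 / (c * (b - 1)) * (r0 + c * τ) ^ (1 - b) := by
      have := (hp τ ⟨hτ.le, le_rfl⟩)
      have : 0 < b - 1 := by linarith
      positivity
    simp only [mul_zero, add_zero]
    linarith
  · exact (intervalIntegrable_iff_integrableOn_Ioc_of_le hτ.le).1 hint
  · filter_upwards [ae_restrict_mem measurableSet_Ioc] with s hs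
    exact Real.rpow_nonneg (hp s ⟨hs.1.le, hs.2⟩).le _

lemma oneD_A {σ c q : ℝ} (hσ : 0 ≤ σ) (hc : 0 < c) (hq : -1 < q) :
    ∫⁻ s in Ioo 0 σ, ENNReal.ofReal ((c * (σ - s)) ^ q) ≤
      ENNReal.ofReal (c ^ q * (σ ^ (q + 1) / (q + 1))) := by
  have hint : IntervalIntegrable (fun s : ℝ => (σ - s) ^ q) volume 0 σ := by
    have := (intervalIntegral.intervalIntegrable_rpow' hq (a := 0) (b := σ)).comp_sub_left σ
    simpa using this.symm
  have hI : ∫ s in (0:ℝ)..σ, (σ - s) ^ q = σ ^ (q + 1) / (q + 1) := by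
    rw [intervalIntegral.integral_comp_sub_left (fun x => x ^ q) σ, sub_self, sub_zero,
      integral_rpow (Or.inl hq), Real.zero_rpow (by linarith), sub_zero]
  have hnn : 0 ≤ᵐ[volume.restrict (Ioc 0 σ)] fun s : ℝ => (σ - s) ^ q := by
    filter_upwards [ae_restrict_mem measurableSet_Ioc] with s hs
    exact Real.rpow_nonneg (by linarith [hs.2]) _
  have h1 : ∫⁻ s in Ioc 0 σ, ENNReal.ofReal ((σ - s) ^ q) =
      ENNReal.ofReal (σ ^ (q + 1) / (q + 1)) := by
    rw [← hI, intervalIntegral.integral_of_le hσ, ofReal_integral_eq_lintegral_ofReal _ hnn]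
    exact (intervalIntegrable_iff_integrableOn_Ioc_of_le hσ).1 hint
  rw [restrict_Ioo_eq_restrict_Ioc, ENNReal.ofReal_mul (by positivity), ← h1,
    ← lintegral_const_mul' _ _ ENNReal.ofReal_ne_top]
  apply le_of_eq
  apply setLIntegral_congr_fun measurableSet_Ioc
  intro s hs
  simp only
  rw [← ENNReal.ofReal_mul (by positivity), Real.mul_rpow hc.le (by linarith [hs.2])]

lemma ennreal_add_sq_le (a b : ENNReal) : (a + b) ^ 2 ≤ 4 * a ^ 2 + 4 * b ^ 2 := by
  rcases le_total a b with h | h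
  · calc (a + b) ^ 2 ≤ (b + b) ^ 2 := by gcongr
      _ = 4 * b ^ 2 := by ring
      _ ≤ _ := le_add_self
  · calc (a + b) ^ 2 ≤ (a + a) ^ 2 := by gcongr
      _ = 4 * a ^ 2 := by ring
      _ ≤ _ := le_self_add

lemma cauchy_schwarz_lintegral {α : Type*} [MeasurableSpace α] (μ : Measure α)
    {f g : α → ENNReal} (hf : AEMeasurable f μ) (hg : AEMeasurable g μ) :
    (∫⁻ x, f x * g x ∂μ) ^ 2 ≤ (∫⁻ x, f x ^ 2 ∂μ) * ∫⁻ x, g x ^ 2 ∂μ := by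
  have h := ENNReal.lintegral_mul_le_Lp_mul_Lq μ Real.HolderConjugate.two_two hf hg
  simp only [Pi.mul_apply, ENNReal.rpow_two] at h
  calc (∫⁻ x, f x * g x ∂μ) ^ 2
      ≤ ((∫⁻ x, f x ^ 2 ∂μ) ^ (1 / 2 : ℝ) * (∫⁻ x, g x ^ 2 ∂μ) ^ (1 / 2 : ℝ)) ^ 2 := by gcongr
    _ = _ := by
      rw [mul_pow, ← ENNReal.rpow_two, ← ENNReal.rpow_two, ← ENNReal.rpow_mul, ← ENNReal.rpow_mul]
      norm_num

lemma inner_bound {Ω E : Set (Euc d)} {r : Euc d → ℝ} {v : Euc d} {c τ : ℝ}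
    (hpos : ∀ y ∈ Ω, 0 < r y) (hE : E ⊆ Ω) (hc : 0 < c)
    (hG : ∀ y ∈ E, ∀ s ∈ Icc 0 τ, y + s • v ∈ Ω ∧ r y + c * s ≤ r (y + s • v))
    {p : ℝ} (hp : -1 < p) :
    ∃ C : ℝ, 0 ≤ C ∧ ∀ z, ∫⁻ s in Ioo 0 τ, E.indicator (fun y => ENNReal.ofReal (r y ^ p)) (z - s • v)
      ≤ Ω.indicator (fun z => ENNReal.ofReal (C * r z ^ (p + 1))) z := by
  set q : ℝ := min p 0 with hq
  have hqp : q ≤ p := min_le_left _ _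
  have hq0 : q ≤ 0 := min_le_right _ _
  have hq1 : -1 < q := lt_min hp (by norm_num)
  have hq1' : 0 < q + 1 := by linarith
  refine ⟨c ^ q * ((1 / c ^ (q + 1)) / (q + 1)), by positivity, ?_⟩
  intro z
  set S : Set ℝ := {s | s ∈ Ioo 0 τ ∧ z - s • v ∈ E} with hS
  by_cases hne : S.Nonempty
  swap
  · have : ∫⁻ s in Ioo 0 τ, E.indicator (fun y => ENNReal.ofReal (r y ^ p)) (z - s • v)
        = ∫⁻ s in Ioo (0:ℝ) τ, 0 := by
      apply setLIntegral_congr_fun measurableSet_Ioo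
      intro s hs
      apply indicator_of_notMem
      intro hm
      exact hne ⟨s, hs, hm⟩
    rw [this]; simp
  have hcmp : ∀ s ∈ S, z ∈ Ω ∧ r (z - s • v) + c * s ≤ r z := by
    intro s hs
    have := hG _ hs.2 s ⟨hs.1.1.le, hs.1.2.le⟩
    simpa using this
  obtain ⟨s0, hs0⟩ := hne
  have hz : z ∈ Ω := (hcmp s0 hs0).1
  have hrz := hpos z hz
  have hub : ∀ s ∈ S, s ≤ r z / c := by
    intro s hs
    rw [le_div_iff₀ hc]
    have := (hcmp s hs).2
    have := hpos _ (hE hs.2)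
    linarith
  set σ := sSup S with hσ
  have hbdd : BddAbove S := ⟨r z / c, hub⟩
  have hσle : σ ≤ r z / c := csSup_le ⟨s0, hs0⟩ hub
  have hσ0 : 0 ≤ σ := hs0.1.1.le.trans (le_csSup hbdd hs0)
  have hlow : ∀ s ∈ S, c * (σ - s) ≤ r (z - s • v) := by
    intro s hs
    have hrs := hpos _ (hE hs.2)
    have : σ ≤ r (z - s • v) / c + s := by
      apply csSup_le ⟨s0, hs0⟩
      intro t ht
      rcases le_total t s with h | h
      · have : 0 < r (z - s • v) / c := by positivity
        linarith
      · have h1 := (hG _ ht.2 (t - s) ⟨by linarith, by linarith [ht.1.2, hs.1.1]⟩).2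
        have h2 : z - t • v + (t - s) • v = z - s • v := by
          rw [sub_smul]; abel
        rw [h2] at h1
        have h3 := hpos _ (hE ht.2)
        rw [← sub_le_iff_le_add, le_div_iff₀ hc]
        linarith
    rw [← sub_le_iff_le_add, le_div_iff₀ hc] at this
    linarith
  rw [indicator_of_mem hz]
  calc ∫⁻ s in Ioo 0 τ, E.indicator (fun y => ENNReal.ofReal (r y ^ p)) (z - s • v)
      = ∫⁻ s, (Ioo 0 τ).indicator
          (fun s => E.indicator (fun y => ENNReal.ofReal (r y ^ p)) (z - s • v)) s := by
        rw [lintegral_indicator measurableSet_Ioo]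
    _ ≤ ∫⁻ s, (Ioo 0 σ).indicator
          (fun s => ENNReal.ofReal (r z ^ (p - q)) * ENNReal.ofReal ((c * (σ - s)) ^ q)) s := by
        apply lintegral_mono_ae
        have hae : ∀ᵐ s : ℝ, s ≠ σ := compl_mem_ae_iff.mpr (measure_singleton σ)
        filter_upwards [hae] with s hsσ
        by_cases hs : s ∈ S
        · have hlt : s < σ := lt_of_le_of_ne (le_csSup hbdd hs) hsσ
          rw [indicator_of_mem hs.1, indicator_of_mem hs.2,
            indicator_of_mem (show s ∈ Ioo 0 σ from ⟨hs.1.1, hlt⟩),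
            ← ENNReal.ofReal_mul (by positivity)]
          apply ENNReal.ofReal_le_ofReal
          have hrs := hpos _ (hE hs.2)
          have h1 : r (z - s • v) ≤ r z := by
            have := (hcmp s hs).2
            have := mul_pos hc hs.1.1
            linarith
          calc r (z - s • v) ^ p = r (z - s • v) ^ (p - q) * r (z - s • v) ^ q := by
                rw [← Real.rpow_add hrs]; ring_nf
            _ ≤ r z ^ (p - q) * (c * (σ - s)) ^ q := by
                apply mul_le_mul
                · exact Real.rpow_le_rpow hrs.le h1 (by linarith)
                · exact Real.rpow_le_rpow_of_nonpos (mul_pos hc (by linarith))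
                    (hlow s hs) hq0
                · positivity
                · positivity
        · have : (Ioo 0 τ).indicator
            (fun s => E.indicator (fun y => ENNReal.ofReal (r y ^ p)) (z - s • v)) s = 0 := by
            by_cases h1 : s ∈ Ioo 0 τ
            · rw [indicator_of_mem h1]
              apply indicator_of_notMem
              intro h2
              exact hs ⟨h1, h2⟩
            · exact indicator_of_notMem h1 _
          rw [this]
          exact zero_le
    _ = ENNReal.ofReal (r z ^ (p - q)) * ∫⁻ s in Ioo 0 σ, ENNReal.ofReal ((c * (σ - s)) ^ q) := by
        rw [lintegral_indicator measurableSet_Ioo, lintegral_const_mul' _ _ ENNReal.ofReal_ne_top]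
    _ ≤ ENNReal.ofReal (r z ^ (p - q)) * ENNReal.ofReal (c ^ q * (σ ^ (q + 1) / (q + 1))) := by
        gcongr
        exact oneD_A hσ0 hc hq1
    _ ≤ _ := by
        rw [← ENNReal.ofReal_mul (by positivity)]
        apply ENNReal.ofReal_le_ofReal
        have h1 : σ ^ (q + 1) ≤ r z ^ (q + 1) / c ^ (q + 1) := by
          rw [← Real.div_rpow hrz.le hc.le]
          exact Real.rpow_le_rpow hσ0 hσle hq1'.le
        have h2 : r z ^ (p + 1) = r z ^ (p - q) * r z ^ (q + 1) := by
          rw [← Real.rpow_add hrz]; ring_nf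
        calc r z ^ (p - q) * (c ^ q * (σ ^ (q + 1) / (q + 1)))
            ≤ r z ^ (p - q) * (c ^ q * ((r z ^ (q + 1) / c ^ (q + 1)) / (q + 1))) := by gcongr
          _ = _ := by rw [h2]; ring

lemma tonelli_bound {Ω E : Set (Euc d)} {r : Euc d → ℝ} {v : Euc d} {c τ : ℝ}
    (hpos : ∀ y ∈ Ω, 0 < r y) (hE : E ⊆ Ω) (hc : 0 < c)
    (hG : ∀ y ∈ E, ∀ s ∈ Icc 0 τ, y + s • v ∈ Ω ∧ r y + c * s ≤ r (y + s • v))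
    (hEm : MeasurableSet E) (hΩm : MeasurableSet Ω) (hrm : Measurable r)
    {p : ℝ} (hp : -1 < p) :
    ∃ C : ENNReal, C ≠ ⊤ ∧ ∀ H : Euc d → ENNReal, Measurable H →
      ∫⁻ y in E, ENNReal.ofReal (r y ^ p) * ∫⁻ s in Ioo 0 τ, H (y + s • v) ≤
        C * ∫⁻ z in Ω, ENNReal.ofReal (r z ^ (p + 1)) * H z := by
  obtain ⟨C, hC0, hC⟩ := inner_bound hpos hE hc hG hp
  refine ⟨ENNReal.ofReal C, ENNReal.ofReal_ne_top, ?_⟩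
  intro H hH
  set φ : Euc d → ENNReal := E.indicator (fun y => ENNReal.ofReal (r y ^ p)) with hφ
  have hφm : Measurable φ := by
    apply Measurable.indicator _ hEm
    fun_prop
  calc ∫⁻ y in E, ENNReal.ofReal (r y ^ p) * ∫⁻ s in Ioo 0 τ, H (y + s • v)
      = ∫⁻ y, ∫⁻ s in Ioo 0 τ, φ y * H (y + s • v) := by
        rw [← lintegral_indicator hEm]
        apply lintegral_congr
        intro y
        rw [lintegral_const_mul _ (by fun_prop)]
        by_cases hy : y ∈ E
        · simp [hφ, hy]
        · simp [hφ, hy]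
    _ = ∫⁻ s in Ioo 0 τ, ∫⁻ y, φ y * H (y + s • v) := by
        apply lintegral_lintegral_swap
        apply Measurable.aemeasurable
        unfold Function.uncurry
        fun_prop
    _ = ∫⁻ s in Ioo 0 τ, ∫⁻ z, φ (z - s • v) * H z := by
        apply lintegral_congr
        intro s
        rw [← lintegral_sub_right_eq_self (fun y => φ y * H (y + s • v)) (s • v)]
        simp
    _ = ∫⁻ z, ∫⁻ s in Ioo 0 τ, φ (z - s • v) * H z := by
        apply lintegral_lintegral_swap
        apply Measurable.aemeasurable
        unfold Function.uncurry
        fun_prop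
    _ = ∫⁻ z, (∫⁻ s in Ioo 0 τ, φ (z - s • v)) * H z := by
        apply lintegral_congr
        intro z
        rw [lintegral_mul_const _ (by fun_prop)]
    _ ≤ ∫⁻ z, Ω.indicator (fun z => ENNReal.ofReal (C * r z ^ (p + 1))) z * H z := by
        apply lintegral_mono
        intro z
        exact mul_le_mul_left (hC z) _
    _ = ∫⁻ z in Ω, ENNReal.ofReal C * (ENNReal.ofReal (r z ^ (p + 1)) * H z) := by
        rw [← lintegral_indicator hΩm]
        apply lintegral_congr
        intro z
        by_cases hz : z ∈ Ω
        · simp [hz, ENNReal.ofReal_mul hC0, mul_assoc]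
        · simp [hz]
    _ = _ := by rw [lintegral_const_mul' _ _ ENNReal.ofReal_ne_top]

lemma local_hardy {Ω E : Set (Euc d)} {r : Euc d → ℝ} {v : Euc d} {c τ : ℝ}
    (hpos : ∀ y ∈ Ω, 0 < r y) (hE : E ⊆ Ω) (hc : 0 < c) (hτ : 0 < τ)
    (hG : ∀ y ∈ E, ∀ s ∈ Icc 0 τ, y + s • v ∈ Ω ∧ r y + c * s ≤ r (y + s • v))
    (hEm : MeasurableSet E) (hΩm : MeasurableSet Ω) (hrm : Measurable r)
    {a : ℝ} (ha : -1 < a) (V : ENNReal) (hV : V ≠ ⊤) :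
    ∃ C : ENNReal, C ≠ ⊤ ∧ ∀ α β : Euc d → ENNReal, Measurable α → Measurable β →
      (∀ y ∈ E, ∀ t ∈ Ioo 0 τ, α y ≤ α (y + t • v) + V * ∫⁻ s in Ioo 0 t, β (y + s • v)) →
      ∫⁻ y in E, ENNReal.ofReal (r y ^ a) * α y ^ 2 ≤
        C * ∫⁻ z in Ω, ENNReal.ofReal (r z ^ (a + 2)) * (α z ^ 2 + β z ^ 2) := by
  set b : ℝ := 1 + (a + 1) / 2 with hb
  have hb1 : 1 < b := by rw [hb]; linarith
  obtain ⟨C1, hC1t, hC1⟩ := tonelli_bound hpos hE hc hG hEm hΩm hrm ha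
  obtain ⟨C2, hC2t, hC2⟩ := tonelli_bound hpos hE hc hG hEm hΩm hrm
    (p := a + 1 - b) (by rw [hb]; linarith)
  set K : ENNReal := ENNReal.ofReal (1 / (c * (b - 1))) with hK
  set T : ENNReal := ENNReal.ofReal (τ / 2) with hT
  have hT0 : T ≠ 0 := by rw [hT]; simp; linarith
  have hTt : T ≠ ⊤ := ENNReal.ofReal_ne_top
  set L : ENNReal := ENNReal.ofReal (2 / (c * τ)) with hL
  refine ⟨T⁻¹ * (4 * (C1 * L) + 4 * V ^ 2 * K * T * C2), ?_, ?_⟩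
  · have hKt : K ≠ ⊤ := ENNReal.ofReal_ne_top
    have hLt : L ≠ ⊤ := ENNReal.ofReal_ne_top
    have hTi : T⁻¹ ≠ ⊤ := ENNReal.inv_ne_top.2 hT0
    finiteness
  intro α β hα hβ hF
  set H1 : Euc d → ENNReal := {z | c * τ / 2 ≤ r z}.indicator (fun z => α z ^ 2) with hH1
  set H2 : Euc d → ENNReal := fun z => ENNReal.ofReal (r z ^ b) * β z ^ 2 with hH2
  have hH1m : Measurable H1 := by
    apply Measurable.indicator (by fun_prop)
    exact measurableSet_le measurable_const hrm
  have hH2m : Measurable H2 := by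
    rw [hH2]; fun_prop
  -- pointwise Cauchy-Schwarz bound
  have hJ : ∀ y ∈ E, (∫⁻ s in Ioo 0 τ, β (y + s • v)) ^ 2 ≤
      K * ENNReal.ofReal (r y ^ (1 - b)) * ∫⁻ s in Ioo 0 τ, H2 (y + s • v) := by
    intro y hy
    have hry := hpos y (hE hy)
    have e1 : ∫⁻ s in Ioo 0 τ, β (y + s • v) = ∫⁻ s in Ioo 0 τ,
        ENNReal.ofReal (r (y + s • v) ^ (-(b / 2))) *
          (ENNReal.ofReal (r (y + s • v) ^ (b / 2)) * β (y + s • v)) := by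
      apply setLIntegral_congr_fun measurableSet_Ioo
      intro s hs
      have h1 := hpos _ (hG y hy s ⟨hs.1.le, hs.2.le⟩).1
      simp only
      rw [← mul_assoc, ← ENNReal.ofReal_mul (by positivity), ← Real.rpow_add h1]
      simp
    rw [e1]
    refine (cauchy_schwarz_lintegral _ (by fun_prop) (by fun_prop)).trans ?_
    apply mul_le_mul'
    · calc ∫⁻ s in Ioo 0 τ, ENNReal.ofReal (r (y + s • v) ^ (-(b / 2))) ^ 2
          ≤ ∫⁻ s in Ioo 0 τ, ENNReal.ofReal ((r y + c * s) ^ (-b)) := by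
            apply setLIntegral_mono' measurableSet_Ioo
            intro s hs
            have h0 := hG y hy s ⟨hs.1.le, hs.2.le⟩
            have h1 := hpos _ h0.1
            rw [← ENNReal.ofReal_pow (by positivity), ← Real.rpow_natCast, ← Real.rpow_mul h1.le]
            apply ENNReal.ofReal_le_ofReal
            rw [show -(b / 2) * ((2 : ℕ) : ℝ) = -b by push_cast; ring]
            apply Real.rpow_le_rpow_of_nonpos _ h0.2 (by linarith)
            have := mul_pos hc hs.1
            linarith
        _ ≤ _ := oneD_B hry hc hb1 hτ
        _ = _ := by
          rw [hK, ENNReal.ofReal_mul]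
          have : 0 < b - 1 := by linarith
          positivity
    · apply le_of_eq
      apply setLIntegral_congr_fun measurableSet_Ioo
      intro s hs
      have h1 := hpos _ (hG y hy s ⟨hs.1.le, hs.2.le⟩).1
      simp only [hH2]
      rw [mul_pow, ← ENNReal.ofReal_pow (by positivity), ← Real.rpow_natCast,
        ← Real.rpow_mul h1.le, show b / 2 * ((2 : ℕ) : ℝ) = b by push_cast; ring]
  have hpt : ∀ y ∈ E, T * (ENNReal.ofReal (r y ^ a) * α y ^ 2) ≤
      4 * (ENNReal.ofReal (r y ^ a) * ∫⁻ s in Ioo 0 τ, H1 (y + s • v)) +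
      4 * V ^ 2 * K * T *
        (ENNReal.ofReal (r y ^ (a + 1 - b)) * ∫⁻ s in Ioo 0 τ, H2 (y + s • v)) := by
    intro y hy
    have hry := hpos y (hE hy)
    set J := ∫⁻ s in Ioo 0 τ, β (y + s • v) with hJdef
    have h1 : T * α y ^ 2 ≤ 4 * (∫⁻ s in Ioo 0 τ, H1 (y + s • v)) + 4 * V ^ 2 * T * J ^ 2 := by
      have hvol : volume (Ioo (τ / 2) τ) = T := by
        rw [Real.volume_Ioo, hT]; congr 1; ring
      calc T * α y ^ 2 = ∫⁻ t in Ioo (τ / 2) τ, α y ^ 2 := by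
            rw [setLIntegral_const, hvol, mul_comm]
        _ ≤ ∫⁻ t in Ioo (τ / 2) τ, (4 * H1 (y + t • v) + 4 * (V * J) ^ 2) := by
            apply setLIntegral_mono' measurableSet_Ioo
            intro t ht
            have ht0 : 0 < t := by linarith [ht.1]
            have h3 : α y ≤ α (y + t • v) + V * J := by
              refine (hF y hy t ⟨ht0, ht.2⟩).trans ?_
              have : ∫⁻ s in Ioo 0 t, β (y + s • v) ≤ J :=
                lintegral_mono_set (Ioo_subset_Ioo_right ht.2.le)
              gcongr
            have h4 : H1 (y + t • v) = α (y + t • v) ^ 2 := by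
              rw [hH1]
              apply indicator_of_mem
              have h5 := (hG y hy t ⟨ht0.le, ht.2.le⟩).2
              have h6 : c * (τ / 2) ≤ c * t := by
                have := ht.1.le
                gcongr
              simp only [mem_ofPred_eq]
              linarith
            rw [h4]
            calc α y ^ 2 ≤ (α (y + t • v) + V * J) ^ 2 := by gcongr
              _ ≤ _ := ennreal_add_sq_le _ _
        _ = 4 * (∫⁻ t in Ioo (τ / 2) τ, H1 (y + t • v)) + 4 * (V * J) ^ 2 * T := by
            rw [lintegral_add_right _ (by fun_prop), lintegral_const_mul _ (by fun_prop),
              setLIntegral_const, hvol]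
        _ ≤ 4 * (∫⁻ t in Ioo 0 τ, H1 (y + t • v)) + 4 * (V * J) ^ 2 * T := by
            gcongr
            linarith
        _ = _ := by ring
    calc T * (ENNReal.ofReal (r y ^ a) * α y ^ 2) = ENNReal.ofReal (r y ^ a) * (T * α y ^ 2) := by
          ring
      _ ≤ ENNReal.ofReal (r y ^ a) * (4 * (∫⁻ s in Ioo 0 τ, H1 (y + s • v)) + 4 * V ^ 2 * T *
            (K * ENNReal.ofReal (r y ^ (1 - b)) * ∫⁻ s in Ioo 0 τ, H2 (y + s • v))) := by
          refine mul_le_mul_right (h1.trans ?_) _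
          have := hJ y hy
          gcongr
      _ = _ := by
          rw [show a + 1 - b = a + (1 - b) by ring, Real.rpow_add hry,
            ENNReal.ofReal_mul (by positivity)]
          ring
  set R := ∫⁻ z in Ω, ENNReal.ofReal (r z ^ (a + 2)) * (α z ^ 2 + β z ^ 2) with hR
  have hmain : T * ∫⁻ y in E, ENNReal.ofReal (r y ^ a) * α y ^ 2 ≤
      (4 * (C1 * L) + 4 * V ^ 2 * K * T * C2) * R := by
    have hm1 : Measurable fun y : Euc d => ∫⁻ s in Ioo 0 τ, H1 (y + s • v) := by
      apply Measurable.lintegral_prod_right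
      fun_prop
    have hm2 : Measurable fun y : Euc d => ∫⁻ s in Ioo 0 τ, H2 (y + s • v) := by
      apply Measurable.lintegral_prod_right
      fun_prop
    calc T * ∫⁻ y in E, ENNReal.ofReal (r y ^ a) * α y ^ 2
        = ∫⁻ y in E, T * (ENNReal.ofReal (r y ^ a) * α y ^ 2) := by
          rw [lintegral_const_mul' _ _ hTt]
      _ ≤ ∫⁻ y in E, (4 * (ENNReal.ofReal (r y ^ a) * ∫⁻ s in Ioo 0 τ, H1 (y + s • v)) +
          4 * V ^ 2 * K * T *
            (ENNReal.ofReal (r y ^ (a + 1 - b)) * ∫⁻ s in Ioo 0 τ, H2 (y + s • v))) :=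
          setLIntegral_mono' hEm hpt
      _ = 4 * (∫⁻ y in E, (ENNReal.ofReal (r y ^ a) * ∫⁻ s in Ioo 0 τ, H1 (y + s • v))) +
          4 * V ^ 2 * K * T *
            ∫⁻ y in E, (ENNReal.ofReal (r y ^ (a + 1 - b)) * ∫⁻ s in Ioo 0 τ, H2 (y + s • v)) := by
          rw [lintegral_add_left (by fun_prop), lintegral_const_mul _ (by fun_prop),
            lintegral_const_mul _ (by fun_prop)]
      _ ≤ 4 * (C1 * ∫⁻ z in Ω, ENNReal.ofReal (r z ^ (a + 1)) * H1 z) +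
          4 * V ^ 2 * K * T *
            (C2 * ∫⁻ z in Ω, ENNReal.ofReal (r z ^ (a + 1 - b + 1)) * H2 z) := by
          have i1 := hC1 H1 hH1m
          have i2 := hC2 H2 hH2m
          gcongr
      _ ≤ 4 * (C1 * (L * R)) + 4 * V ^ 2 * K * T * (C2 * R) := by
          have i1 : ∫⁻ z in Ω, ENNReal.ofReal (r z ^ (a + 1)) * H1 z ≤ L * R := by
            rw [hR, ← lintegral_const_mul' _ _ ENNReal.ofReal_ne_top]
            apply setLIntegral_mono' hΩm
            intro z hz
            have hrz := hpos z hz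
            by_cases h : c * τ / 2 ≤ r z
            · rw [hH1, indicator_of_mem (show z ∈ {z | c * τ / 2 ≤ r z} from h), ← mul_assoc,
                ← ENNReal.ofReal_mul (by positivity)]
              apply mul_le_mul' _ le_self_add
              apply ENNReal.ofReal_le_ofReal
              rw [show a + 2 = a + 1 + 1 by ring, Real.rpow_add hrz (a + 1) 1, Real.rpow_one]
              have h7 : 1 ≤ 2 / (c * τ) * r z := by
                rw [div_mul_eq_mul_div, le_div_iff₀ (by positivity)]
                linarith
              have h8 : 0 < r z ^ (a + 1) := by positivity
              nlinarith
            · rw [hH1, indicator_of_notMem (show z ∉ {z | c * τ / 2 ≤ r z} from h), mul_zero]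
              exact zero_le
          have i2 : ∫⁻ z in Ω, ENNReal.ofReal (r z ^ (a + 1 - b + 1)) * H2 z ≤ R := by
            rw [hR]
            apply setLIntegral_mono' hΩm
            intro z hz
            have hrz := hpos z hz
            simp only [hH2]
            rw [← mul_assoc, ← ENNReal.ofReal_mul (by positivity), ← Real.rpow_add hrz,
              show a + 1 - b + 1 + b = a + 2 by ring]
            gcongr
            exact le_add_self
          gcongr
      _ = _ := by ring
  calc ∫⁻ y in E, ENNReal.ofReal (r y ^ a) * α y ^ 2
      = T⁻¹ * (T * ∫⁻ y in E, ENNReal.ofReal (r y ^ a) * α y ^ 2) := by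
        rw [← mul_assoc, ENNReal.inv_mul_cancel hT0 hTt, one_mul]
    _ ≤ T⁻¹ * ((4 * (C1 * L) + 4 * V ^ 2 * K * T * C2) * R) := by gcongr
    _ = _ := by ring

lemma ftc_bound {F : Type*} [NormedAddCommGroup F] [NormedSpace ℝ F] [CompleteSpace F]
    {Ω : Set (Euc d)} {g : Euc d → F} {g' : Euc d → (Euc d →L[ℝ] F)}
    (hg : ∀ x ∈ Ω, HasFDerivAt g (g' x) x) (hg' : ContinuousOn g' Ω)
    {y v : Euc d} {t : ℝ} (ht : 0 < t) (hseg : ∀ s ∈ Icc 0 t, y + s • v ∈ Ω) :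
    ‖g y‖ₑ ≤ ‖g (y + t • v)‖ₑ + ‖v‖ₑ * ∫⁻ s in Ioo 0 t, ‖g' (y + s • v)‖ₑ := by
  have hc : ContinuousOn (fun s : ℝ => g' (y + s • v)) (Icc 0 t) :=
    hg'.comp (by fun_prop) hseg
  have hcv : ContinuousOn (fun s : ℝ => g' (y + s • v) v) (Icc 0 t) :=
    hc.clm_apply continuousOn_const
  have hI := intervalIntegral.integral_eq_sub_of_hasDerivAt (a := 0) (b := t)
    (f := fun s : ℝ => g (y + s • v)) (f' := fun s : ℝ => g' (y + s • v) v) (by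
      intro s hs
      rw [uIcc_of_le ht.le] at hs
      have h4 : HasDerivAt (fun t : ℝ => y + t • v) v s := by
        simpa using ((hasDerivAt_id s).smul_const v).const_add y
      exact (hg _ (hseg s hs)).comp_hasDerivAt s h4)
    (by apply ContinuousOn.intervalIntegrable; rwa [uIcc_of_le ht.le])
  simp only [zero_smul, add_zero] at hI
  have h1 : g y = g (y + t • v) - ∫ s in (0:ℝ)..t, g' (y + s • v) v := by rw [hI]; abel
  have h2 : ‖∫ s in (0:ℝ)..t, g' (y + s • v) v‖ₑ ≤
      ‖v‖ₑ * ∫⁻ s in Ioo 0 t, ‖g' (y + s • v)‖ₑ := by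
    rw [intervalIntegral.integral_of_le ht.le, ← restrict_Ioo_eq_restrict_Ioc,
      ← lintegral_const_mul' _ _ enorm_ne_top]
    refine (enorm_integral_le_lintegral_enorm _).trans ?_
    apply lintegral_mono
    intro s
    simp only
    rw [mul_comm]
    exact ContinuousLinearMap.le_opENorm _ _
  calc ‖g y‖ₑ = ‖g (y + t • v) - ∫ s in (0:ℝ)..t, g' (y + s • v) v‖ₑ := by rw [← h1]
    _ ≤ ‖g (y + t • v)‖ₑ + ‖∫ s in (0:ℝ)..t, g' (y + s • v) v‖ₑ := enorm_sub_le
    _ ≤ _ := by gcongr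

/-- Abstract fundamental theorem of calculus bound along segments. -/
def SegBound (Ω : Set (Euc d)) (α β : Euc d → ENNReal) : Prop :=
  ∀ (y v : Euc d) (t : ℝ), 0 < t → (∀ s ∈ Icc 0 t, y + s • v ∈ Ω) →
    α y ≤ α (y + t • v) + ‖v‖ₑ * ∫⁻ s in Ioo 0 t, β (y + s • v)

lemma global_hardy {ε : ℝ} {Ω : Set (Euc d)} {r : Euc d → ℝ} (hr : IsDefiningFunction ε Ω r)
    {a : ℝ} (ha : -1 < a) :
    ∃ C : ENNReal, C ≠ ⊤ ∧ ∀ α β : Euc d → ENNReal, Measurable α → Measurable β →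
      SegBound Ω α β →
      ∫⁻ y in Ω, ENNReal.ofReal (r y ^ a) * α y ^ 2 ≤
        C * ∫⁻ z in Ω, ENNReal.ofReal (r z ^ (a + 2)) * (α z ^ 2 + β z ^ 2) := by
  have hr' := hr
  obtain ⟨ho, -, hbd, hnn, hΩ, hC, -, -⟩ := hr'
  have hpos : ∀ y ∈ Ω, 0 < r y := fun y h => by rw [hΩ] at h; exact h
  have hrc : ContinuousOn r Ω := hC.continuousOn.mono subset_closure
  have hrm : Measurable r := by
    classical
    have h1 : r = Ω.piecewise r (fun _ => 0) := by
      ext y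
      by_cases hy : y ∈ Ω
      · simp [hy]
      · have h2 : ¬ 0 < r y := fun h => hy (by rw [hΩ]; exact h)
        have := hnn y
        simp only [hy, not_false_eq_true, piecewise_eq_of_notMem]
        linarith
    rw [h1]
    exact hrc.measurable_piecewise continuousOn_const ho.measurableSet
  have key : ∃ C : ENNReal, C ≠ ⊤ ∧ ∀ α β : Euc d → ENNReal, Measurable α → Measurable β →
      SegBound Ω α β →
      ∫⁻ y in Ω ∩ closure Ω, ENNReal.ofReal (r y ^ a) * α y ^ 2 ≤
        C * ∫⁻ z in Ω, ENNReal.ofReal (r z ^ (a + 2)) * (α z ^ 2 + β z ^ 2) := by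
    refine IsCompact.induction_on (p := fun S => ∃ C : ENNReal, C ≠ ⊤ ∧
      ∀ α β : Euc d → ENNReal, Measurable α → Measurable β →
      SegBound Ω α β →
      ∫⁻ y in Ω ∩ S, ENNReal.ofReal (r y ^ a) * α y ^ 2 ≤
        C * ∫⁻ z in Ω, ENNReal.ofReal (r z ^ (a + 2)) * (α z ^ 2 + β z ^ 2))
      hbd.isCompact_closure ?_ ?_ ?_ ?_
    · exact ⟨0, by simp, by simp⟩
    · rintro S S' hSS ⟨C, hCt, h⟩
      refine ⟨C, hCt, fun α β hα hβ hF => le_trans ?_ (h α β hα hβ hF)⟩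
      exact lintegral_mono_set (inter_subset_inter_right _ hSS)
    · rintro S S' ⟨C, hCt, h⟩ ⟨C', hCt', h'⟩
      refine ⟨C + C', by finiteness, fun α β hα hβ hF => ?_⟩
      rw [inter_union_distrib_left, add_mul]
      exact (lintegral_union_le _ _ _).trans (add_le_add (h α β hα hβ hF) (h' α β hα hβ hF))
    · intro x hx
      by_cases hxΩ : x ∈ Ω
      · have hrx := hpos x hxΩ
        have hev : ∀ᶠ y in nhds x, r x / 2 < r y :=
          (hrc.continuousAt (ho.mem_nhds hxΩ)).eventually_const_lt (by linarith)
        refine ⟨{y | r x / 2 < r y}, mem_nhdsWithin_of_mem_nhds hev,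
          ENNReal.ofReal ((r x / 2) ^ (-2 : ℝ)), ENNReal.ofReal_ne_top, fun α β hα hβ hF => ?_⟩
        rw [← lintegral_const_mul' _ _ ENNReal.ofReal_ne_top]
        have hm : MeasurableSet (Ω ∩ {y | r x / 2 < r y}) :=
          ho.measurableSet.inter (measurableSet_lt measurable_const hrm)
        refine le_trans (setLIntegral_mono' hm (g := fun z => ENNReal.ofReal ((r x / 2) ^ (-2 : ℝ)) *
          (ENNReal.ofReal (r z ^ (a + 2)) * (α z ^ 2 + β z ^ 2))) ?_)
          (lintegral_mono_set inter_subset_left)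
        rintro z ⟨hz, hz2⟩
        have hrz := hpos z hz
        rw [← mul_assoc, ← ENNReal.ofReal_mul (by positivity)]
        apply mul_le_mul' _ le_self_add
        apply ENNReal.ofReal_le_ofReal
        calc r z ^ a = r z ^ (-2 : ℝ) * r z ^ (a + 2) := by
              rw [← Real.rpow_add hrz]; ring_nf
          _ ≤ _ := by
            gcongr ?_ * _
            exact Real.rpow_le_rpow_of_nonpos (by linarith) (le_of_lt hz2) (by norm_num)
      · have hfr : x ∈ frontier Ω := ⟨hx, by rwa [ho.interior_eq]⟩
        obtain ⟨v, c, τ, δ, hc, hτ, hδ, hG⟩ := geom_boundary hr hfr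
        obtain ⟨C, hCt, h⟩ := local_hardy (E := Ω ∩ Metric.ball x δ) hpos inter_subset_left hc hτ
          (fun y hy s hs => hG y hy.1 hy.2 s hs)
          (ho.measurableSet.inter Metric.isOpen_ball.measurableSet) ho.measurableSet hrm ha
          ‖v‖ₑ enorm_ne_top
        refine ⟨Metric.ball x δ, mem_nhdsWithin_of_mem_nhds (Metric.ball_mem_nhds x hδ), C, hCt,
          fun α β hα hβ hF => h α β hα hβ ?_⟩
        intro y hy t ht
        exact hF y v t ht.1 (fun s hs => (hG y hy.1 hy.2 s ⟨hs.1, hs.2.trans ht.2.le⟩).1)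
  rwa [inter_eq_left.mpr subset_closure] at key

/-- extended-real version of the weighted `L²` norm squared of the `i`-th derivative -/
def wInt (r : Euc d → ℝ) (Ω : Set (Euc d)) (f : Euc d → ℝ) (i : ℕ) (lam : ℝ) : ENNReal :=
  ∫⁻ x in Ω, ENNReal.ofReal (((r x) ^ lam * ‖iteratedFDeriv ℝ i f x‖) ^ 2)

lemma wInt_step {ε : ℝ} {Ω : Set (Euc d)} {r : Euc d → ℝ} (hr : IsDefiningFunction ε Ω r)
    {lam : ℝ} (hl : -(1 / 2 : ℝ) < lam) (n : ℕ) :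
    ∃ C : ENNReal, C ≠ ⊤ ∧ ∀ f : Euc d → ℝ, ContDiffOn ℝ n f Ω → ∀ i, i + 1 ≤ n →
      wInt r Ω f i lam ≤ C * (wInt r Ω f i (lam + 1) + wInt r Ω f (i + 1) (lam + 1)) := by
  obtain ⟨C, hCt, hC⟩ := global_hardy hr (a := 2 * lam) (by linarith)
  refine ⟨C, hCt, ?_⟩
  intro f hf i hi
  obtain ⟨ho, -, hbd, hnn, hΩ, hCr, -⟩ := hr
  have hpos : ∀ y ∈ Ω, 0 < r y := fun y h => by rw [hΩ] at h; exact h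
  have hEq : ∀ j : ℕ, EqOn (iteratedFDerivWithin ℝ j f Ω) (iteratedFDeriv ℝ j f) Ω :=
    fun j => iteratedFDerivWithin_of_isOpen j ho
  have hcont : ∀ j ≤ n, ContinuousOn (iteratedFDeriv ℝ j f) Ω := fun j hj =>
    (hf.continuousOn_iteratedFDerivWithin (by exact_mod_cast hj) ho.uniqueDiffOn).congr
      (hEq j).symm
  have hdiff : ∀ x ∈ Ω, HasFDerivAt (iteratedFDeriv ℝ i f) (fderiv ℝ (iteratedFDeriv ℝ i f) x) x := by
    intro x hx
    have h1 := (hf.differentiableOn_iteratedFDerivWithin (m := i)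
      (by exact_mod_cast hi) ho.uniqueDiffOn).congr (hEq i).symm
    exact (h1.differentiableAt (ho.mem_nhds hx)).hasFDerivAt
  have hg'c : ContinuousOn (fderiv ℝ (iteratedFDeriv ℝ i f)) Ω := by
    rw [fderiv_iteratedFDeriv]
    exact (LinearIsometryEquiv.continuous _).comp_continuousOn (hcont (i + 1) hi)
  classical
  set α : Euc d → ENNReal := Ω.piecewise (fun x => ‖iteratedFDeriv ℝ i f x‖ₑ) (fun _ => 0) with hα
  set β : Euc d → ENNReal :=
    Ω.piecewise (fun x => ‖iteratedFDeriv ℝ (i + 1) f x‖ₑ) (fun _ => 0) with hβ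
  have hαm : Measurable α :=
    ContinuousOn.measurable_piecewise (hcont i (by omega)).enorm continuousOn_const ho.measurableSet
  have hβm : Measurable β :=
    ContinuousOn.measurable_piecewise (hcont (i + 1) hi).enorm continuousOn_const ho.measurableSet
  have hα1 : ∀ x ∈ Ω, α x = ‖iteratedFDeriv ℝ i f x‖ₑ := fun x hx => by simp [hα, hx]
  have hβ2 : ∀ x ∈ Ω, β x = ‖iteratedFDeriv ℝ (i + 1) f x‖ₑ := fun x hx => by simp [hβ, hx]
  have hβ1 : ∀ x ∈ Ω, β x = ‖fderiv ℝ (iteratedFDeriv ℝ i f) x‖ₑ := fun x hx => by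
    rw [hβ2 x hx]
    symm
    rw [← ofReal_norm, norm_fderiv_iteratedFDeriv, ofReal_norm]
  have hseg : SegBound Ω α β := by
    intro y v t ht hs
    rw [hα1 y (by simpa using hs 0 ⟨le_rfl, ht.le⟩), hα1 _ (hs t ⟨ht.le, le_rfl⟩)]
    refine (ftc_bound hdiff hg'c ht hs).trans (le_of_eq ?_)
    congr 2
    apply setLIntegral_congr_fun measurableSet_Ioo
    intro s hs'
    exact (hβ1 _ (hs s ⟨hs'.1.le, hs'.2.le⟩)).symm
  have hw : ∀ (j : ℕ) (l : ℝ), ∀ x ∈ Ω,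
      ENNReal.ofReal (((r x) ^ l * ‖iteratedFDeriv ℝ j f x‖) ^ 2) =
        ENNReal.ofReal (r x ^ (2 * l)) * ‖iteratedFDeriv ℝ j f x‖ₑ ^ 2 := by
    intro j l x hx
    have hrx := hpos x hx
    rw [mul_pow, ENNReal.ofReal_mul (by positivity), ← ofReal_norm,
      ENNReal.ofReal_pow (norm_nonneg _), ← Real.rpow_natCast, ← Real.rpow_mul hrx.le]
    congr 3
    push_cast; ring
  have h := hC α β hαm hβm hseg
  have e1 : wInt r Ω f i lam = ∫⁻ y in Ω, ENNReal.ofReal (r y ^ (2 * lam)) * α y ^ 2 := by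
    apply setLIntegral_congr_fun ho.measurableSet
    intro x hx
    simp only
    rw [hw i lam x hx, hα1 x hx]
  have hrm' : AEMeasurable (fun x => ENNReal.ofReal (((r x) ^ (lam + 1) *
      ‖iteratedFDeriv ℝ i f x‖) ^ 2)) (volume.restrict Ω) := by
    apply AEMeasurable.ennreal_ofReal
    apply ContinuousOn.aemeasurable _ ho.measurableSet
    apply ContinuousOn.pow
    apply ContinuousOn.mul _ (hcont i (by omega)).norm
    exact (hCr.continuousOn.mono subset_closure).rpow_const
      (fun x hx => Or.inl (hpos x hx).ne')
  have e2 : wInt r Ω f i (lam + 1) + wInt r Ω f (i + 1) (lam + 1) =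
      ∫⁻ z in Ω, ENNReal.ofReal (r z ^ (2 * lam + 2)) * (α z ^ 2 + β z ^ 2) := by
    unfold wInt
    rw [← lintegral_add_left' hrm']
    apply setLIntegral_congr_fun ho.measurableSet
    intro x hx
    simp only
    rw [hw i _ x hx, hw (i + 1) _ x hx, hα1 x hx, hβ2 x hx,
      show 2 * (lam + 1) = 2 * lam + 2 by ring, mul_add]
  rw [e1, e2]
  exact h

lemma wInt_iter {ε : ℝ} {Ω : Set (Euc d)} {r : Euc d → ℝ} (hr : IsDefiningFunction ε Ω r)
    (n k : ℕ) : ∀ {lam : ℝ}, -(1 / 2 : ℝ) < lam →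
    ∃ C : ENNReal, C ≠ ⊤ ∧ ∀ f : Euc d → ℝ, ContDiffOn ℝ n f Ω → ∀ i, i + k ≤ n →
      wInt r Ω f i lam ≤ C * ∑ j ∈ Finset.range (n + 1), wInt r Ω f j (lam + k) := by
  induction k with
  | zero =>
    intro lam hl
    refine ⟨1, by simp, fun f hf i hi => ?_⟩
    simp only [Nat.cast_zero, add_zero, one_mul]
    exact Finset.single_le_sum (f := fun j => wInt r Ω f j lam) (fun _ _ => zero_le)
      (Finset.mem_range.2 (by omega))
  | succ k ih =>
    intro lam hl
    obtain ⟨C1, hC1, h1⟩ := wInt_step hr hl n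
    obtain ⟨C2, hC2, h2⟩ := ih (lam := lam + 1) (by linarith)
    refine ⟨C1 * (C2 + C2), by finiteness, fun f hf i hi => ?_⟩
    have e : lam + ((k + 1 : ℕ) : ℝ) = lam + 1 + k := by push_cast; ring
    rw [e]
    calc wInt r Ω f i lam ≤ C1 * (wInt r Ω f i (lam + 1) + wInt r Ω f (i + 1) (lam + 1)) :=
          h1 f hf i (by omega)
      _ ≤ C1 * (C2 * (∑ j ∈ Finset.range (n + 1), wInt r Ω f j (lam + 1 + k)) +
          C2 * (∑ j ∈ Finset.range (n + 1), wInt r Ω f j (lam + 1 + k))) := by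
          gcongr
          · exact h2 f hf i (by omega)
          · exact h2 f hf (i + 1) (by omega)
      _ = _ := by ring

/-- **Hardy-type embedding of weighted Sobolev spaces** (Lemma 2.3):
if `s₁ > s₂ ≥ 0`, `λ₁ > λ₂ > −1/2` and `s₁ − λ₁ = s₂ − λ₂`, then
`H^{s₁,λ₁}_r(Ω) ↪ H^{s₂,λ₂}_r(Ω)` continuously. -/
theorem hardy_type_embedding
    {d : ℕ} (hd : 1 ≤ d) {ε : ℝ} (hε : 0 < ε)
    (Ω : Set (Euc d)) (r : Euc d → ℝ) (hr : IsDefiningFunction ε Ω r)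
    (s₁ s₂ : ℕ) (lam₁ lam₂ : ℝ)
    (hs : s₂ < s₁) (hlam₂ : -(1/2 : ℝ) < lam₂) (hlam : lam₂ < lam₁)
    (hrel : (s₁ : ℝ) - lam₁ = (s₂ : ℝ) - lam₂) :
    ∃ C > (0:ℝ), ∀ f : Euc d → ℝ, ContDiffOn ℝ s₁ f Ω →
      (∀ i ≤ s₁, IntegrableOn (fun x => ((r x) ^ lam₁ * ‖iteratedFDeriv ℝ i f x‖) ^ 2) Ω) →
      Real.sqrt (sobNormSq r Ω s₂ lam₂ f) ≤ C * Real.sqrt (sobNormSq r Ω s₁ lam₁ f) := by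
  obtain ⟨C, hCt, hC⟩ := wInt_iter hr s₁ (s₁ - s₂) hlam₂
  have hl1 : lam₂ + ((s₁ - s₂ : ℕ) : ℝ) = lam₁ := by
    rw [Nat.cast_sub hs.le]; linarith
  rw [hl1] at hC
  set M : ℝ := (s₂ + 1) * C.toReal + 1 with hM
  have hM0 : 0 < M := by positivity
  refine ⟨Real.sqrt M, Real.sqrt_pos.2 hM0, fun f hf hint => ?_⟩
  rw [← Real.sqrt_mul hM0.le]
  apply Real.sqrt_le_sqrt
  have hN0 : 0 ≤ sobNormSq r Ω s₁ lam₁ f :=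
    Finset.sum_nonneg fun i _ => integral_nonneg fun x => sq_nonneg _
  have hN : ∑ j ∈ Finset.range (s₁ + 1), wInt r Ω f j lam₁ =
      ENNReal.ofReal (sobNormSq r Ω s₁ lam₁ f) := by
    unfold sobNormSq
    rw [ENNReal.ofReal_sum_of_nonneg (fun i _ => integral_nonneg fun x => sq_nonneg _)]
    apply Finset.sum_congr rfl
    intro i hi
    rw [ofReal_integral_eq_lintegral_ofReal (hint i (by
      have := Finset.mem_range.1 hi; omega)) (Filter.Eventually.of_forall fun x => sq_nonneg _)]
    rfl
  have hone : ∀ i ∈ Finset.range (s₂ + 1),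
      ∫ x in Ω, ((r x) ^ lam₂ * ‖iteratedFDeriv ℝ i f x‖) ^ 2 ≤
        C.toReal * sobNormSq r Ω s₁ lam₁ f := by
    intro i hi
    have h1 := hC f hf i (by have := Finset.mem_range.1 hi; omega)
    have h2 : ENNReal.ofReal (∫ x in Ω, ((r x) ^ lam₂ * ‖iteratedFDeriv ℝ i f x‖) ^ 2) ≤
        wInt r Ω f i lam₂ := by
      unfold wInt
      rw [← Real.enorm_of_nonneg (integral_nonneg fun x => sq_nonneg _)]
      refine (enorm_integral_le_lintegral_enorm _).trans (le_of_eq ?_)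
      apply lintegral_congr
      intro x
      exact Real.enorm_of_nonneg (sq_nonneg _)
    rw [hN, ← ENNReal.ofReal_toReal hCt, ← ENNReal.ofReal_mul ENNReal.toReal_nonneg] at h1
    exact (ENNReal.ofReal_le_ofReal_iff (by positivity)).1 (h2.trans h1)
  calc sobNormSq r Ω s₂ lam₂ f
      ≤ ∑ i ∈ Finset.range (s₂ + 1), C.toReal * sobNormSq r Ω s₁ lam₁ f := Finset.sum_le_sum hone
    _ = (s₂ + 1) * C.toReal * sobNormSq r Ω s₁ lam₁ f := by
      simp [mul_assoc]
    _ ≤ M * sobNormSq r Ω s₁ lam₁ f := by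
      rw [hM]
      gcongr
      linarith
end
end

section
/- Morrey-type embedding for weighted Sobolev spaces: Let Ω ⊂ ℝ^d be a bounded domain with C^{1+ε_*} boundary and r a non-degenerate defining function of Ω. Let s be a positive integer and 0 < λ ≤ s with s − λ − d/2 > 0. Then for every Hölder exponent γ with 0 < γ < 1 and γ ≤ s − λ − d/2 (with equality allowed only if s − λ − d/2 is not an integer), there exists a constant C such that ‖f‖_{C^γ(Ω)} ≤ C ‖f‖_{H^{s,λ}_r(Ω)} for all f, where ‖f‖_{C^γ(Ω)} := ‖f‖_{L^∞(Ω)} + sup_{x≠y∈Ω} |f(x)−f(y)|/|x−y|^γ. -/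
open MeasureTheory Set

noncomputable section

variable {d : ℕ}

/-- segments in the cone directions stay inside -/
lemma cone_boundary {ε : ℝ} (hε : 0 < ε) {Ω : Set (Euc d)} {r : Euc d → ℝ}
    (hr : IsDefiningFunction ε Ω r) {p : Euc d} (hp : p ∈ frontier Ω) :
    ∃ e : Euc d, ∃ δ > (0:ℝ), ∃ ρ > (0:ℝ), ∃ c > (0:ℝ), ∀ x ∈ Ω ∩ Metric.ball p ρ,
      ∀ v ∈ Metric.closedBall e δ, ∀ t ∈ Icc (0:ℝ) 1, x + t • v ∈ Ω ∧ c * t ≤ r (x + t • v) := by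
  obtain ⟨hO, -, -, hr0, hΩ, hC, ⟨K, hK⟩, hA⟩ := hr
  set A := fderivWithin ℝ r (closure Ω) p with hAdef
  have hA0 : A ≠ 0 := hA p hp
  obtain ⟨e₀, he₀⟩ : ∃ e, 0 < A e := by
    obtain ⟨e, he⟩ := ContinuousLinearMap.exists_ne_zero hA0
    rcases lt_or_gt_of_ne he with h | h
    · exact ⟨-e, by simpa using h⟩
    · exact ⟨e, h⟩
  set a := A e₀ with ha
  have hpc : p ∈ closure Ω := frontier_subset_closure hp
  set R := ‖e₀‖ + 1 with hR
  have hRpos : 0 < R := by positivity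
  -- δ₀ radius of directions
  obtain ⟨δ₀, hδ₀, hδ₀1, hδ₀a⟩ : ∃ δ₀ > (0:ℝ), δ₀ ≤ 1 ∧ ‖A‖ * δ₀ ≤ a / 2 := by
    refine ⟨min 1 (a / (2 * (‖A‖ + 1))), by positivity, min_le_left _ _, ?_⟩
    calc ‖A‖ * min 1 (a / (2 * (‖A‖ + 1))) ≤ (‖A‖ + 1) * (a / (2 * (‖A‖ + 1))) := by
          gcongr
          · linarith
          · exact min_le_right _ _
      _ = a / 2 := by field_simp
  obtain ⟨ρ₁, hρ₁, hρ₁K⟩ : ∃ ρ₁ > (0:ℝ), |K| * ρ₁ ^ ε * R ≤ a / 4 := by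
    have : Filter.Tendsto (fun x : ℝ => |K| * x ^ ε * R) (nhdsWithin 0 (Ioi 0)) (nhds 0) := by
      have h1 : ContinuousAt (fun x : ℝ => |K| * x ^ ε * R) 0 := by
        have := Real.continuousAt_rpow_const (0:ℝ) ε (Or.inr hε.le)
        fun_prop
      have h2 := h1.tendsto
      simp only [Real.zero_rpow hε.ne', mul_zero, zero_mul] at h2
      exact h2.mono_left nhdsWithin_le_nhds
    have h3 := (this.eventually (ge_mem_nhds (show (0:ℝ) < a / 4 by positivity))).and
      self_mem_nhdsWithin
    obtain ⟨x, hx1, hx2⟩ := h3.exists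
    exact ⟨x, hx2, hx1⟩
  have hgrad : ∀ z ∈ closure Ω ∩ Metric.ball p ρ₁, ∀ v ∈ Metric.closedBall e₀ δ₀,
      a / 4 ≤ fderivWithin ℝ r (closure Ω) z v := by
    intro z hz v hv
    have hv' : ‖v - e₀‖ ≤ δ₀ := by simpa [dist_eq_norm] using hv
    have hvR : ‖v‖ ≤ R := by
      calc ‖v‖ = ‖(v - e₀) + e₀‖ := by simp
        _ ≤ ‖v - e₀‖ + ‖e₀‖ := norm_add_le _ _
        _ ≤ R := by rw [hR]; linarith
    have h1 : |A (v - e₀)| ≤ a / 2 := by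
      calc |A (v - e₀)| ≤ ‖A‖ * ‖v - e₀‖ := A.le_opNorm _
        _ ≤ ‖A‖ * δ₀ := by gcongr
        _ ≤ a / 2 := hδ₀a
    have h2 : |(fderivWithin ℝ r (closure Ω) z - A) v| ≤ a / 4 := by
      calc |(fderivWithin ℝ r (closure Ω) z - A) v|
          ≤ ‖fderivWithin ℝ r (closure Ω) z - A‖ * ‖v‖ := by
            rw [← Real.norm_eq_abs]; exact ContinuousLinearMap.le_opNorm _ _
        _ ≤ (|K| * ρ₁ ^ ε) * R := by
            gcongr
            refine (hK z hz.1 p hpc).trans ?_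
            have hd' : dist z p ≤ ρ₁ := (Metric.mem_ball.1 hz.2).le
            gcongr
            exact le_abs_self K
        _ ≤ a / 4 := hρ₁K
    rw [map_sub, abs_le] at h1
    rw [_root_.sub_apply, abs_le] at h2
    linarith [h1.1, h2.1]
  -- scaling
  set τ := ρ₁ / (4 * R) with hτ
  have hτ0 : 0 < τ := by positivity
  refine ⟨τ • e₀, τ * δ₀, by positivity, ρ₁ / 2, by positivity, τ * (a / 4), by positivity, ?_⟩
  rintro x ⟨hxΩ, hxp⟩ v hv
  have hτv : τ⁻¹ • v ∈ Metric.closedBall e₀ δ₀ := by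
    rw [Metric.mem_closedBall, dist_eq_norm] at hv ⊢
    have : τ⁻¹ • v - e₀ = τ⁻¹ • (v - τ • e₀) := by
      rw [smul_sub, smul_smul, inv_mul_cancel₀ hτ0.ne', one_smul]
    rw [this, norm_smul, norm_inv, Real.norm_of_nonneg hτ0.le, inv_mul_le_iff₀ hτ0]
    exact hv
  have hvn : ‖v‖ ≤ ρ₁ / 4 := by
    have h1 : ‖τ⁻¹ • v‖ ≤ R := by
      rw [Metric.mem_closedBall, dist_eq_norm] at hτv
      calc ‖τ⁻¹ • v‖ = ‖(τ⁻¹ • v - e₀) + e₀‖ := by simp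
        _ ≤ ‖τ⁻¹ • v - e₀‖ + ‖e₀‖ := norm_add_le _ _
        _ ≤ R := by rw [hR]; linarith
    rw [norm_smul, norm_inv, Real.norm_of_nonneg hτ0.le, inv_mul_le_iff₀ hτ0] at h1
    calc ‖v‖ ≤ τ * R := h1
      _ = ρ₁ / 4 := by rw [hτ]; field_simp
  have hball : ∀ t ∈ Icc (0:ℝ) 1, x + t • v ∈ Metric.ball p ρ₁ := by
    intro t ht
    rw [Metric.mem_ball, dist_eq_norm] at hxp ⊢
    calc ‖x + t • v - p‖ = ‖(x - p) + t • v‖ := by congr 1; abel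
      _ ≤ ‖x - p‖ + ‖t • v‖ := norm_add_le _ _
      _ ≤ ‖x - p‖ + 1 * ‖v‖ := by
          rw [norm_smul, Real.norm_of_nonneg ht.1]; gcongr; exact ht.2
      _ < ρ₁ := by linarith
  have hderiv : ∀ t ∈ Icc (0:ℝ) 1, x + t • v ∈ Ω →
      ∃ D, HasDerivAt (fun t : ℝ => r (x + t • v)) D t ∧ τ * (a / 4) ≤ D := by
    intro t ht hz
    have hz' := subset_closure hz
    have hnh : closure Ω ∈ nhds (x + t • v) := Filter.mem_of_superset (hO.mem_nhds hz) subset_closure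
    have h1 := (hC.differentiableOn (by norm_num) _ hz').hasFDerivWithinAt.hasFDerivAt hnh
    refine ⟨fderivWithin ℝ r (closure Ω) (x + t • v) v, ?_, ?_⟩
    · have h2 : HasDerivAt (fun t : ℝ => x + t • v) v t := by
        simpa using ((hasDerivAt_id t).smul_const v).const_add x
      exact h1.comp_hasDerivAt t h2
    · have h3 := hgrad _ ⟨hz', hball t ht⟩ _ hτv
      rw [map_smul, smul_eq_mul] at h3
      calc τ * (a / 4) ≤ τ * (τ⁻¹ * fderivWithin ℝ r (closure Ω) (x + t • v) v) := by gcongr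
        _ = _ := by field_simp
  have hgrow : ∀ T ∈ Icc (0:ℝ) 1, (∀ t ∈ Ico 0 T, x + t • v ∈ Ω) →
      r x + τ * (a / 4) * T ≤ r (x + T • v) := by
    intro T hT hin
    rcases hT.1.eq_or_lt with h0 | h0
    · rw [← h0]; simp
    have hTc : x + T • v ∈ closure Ω := by
      have hc : ContinuousWithinAt (fun t : ℝ => x + t • v) (Ico 0 T) T := by fun_prop
      refine hc.mem_closure ?_ (fun t ht => hin t ht)
      rw [closure_Ico h0.ne]; exact ⟨h0.le, le_rfl⟩
    have hcl : ∀ t ∈ Icc 0 T, x + t • v ∈ closure Ω := by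
      intro t ht
      rcases ht.2.eq_or_lt with h | h
      · rw [h]; exact hTc
      · exact subset_closure (hin t ⟨ht.1, h⟩)
    have hcont : ContinuousOn (fun t : ℝ => r (x + t • v)) (Icc 0 T) :=
      hC.continuousOn.comp (by fun_prop) hcl
    have key := Convex.mul_sub_le_image_sub_of_le_deriv (convex_Icc 0 T) hcont
      (C := τ * (a / 4)) (by
        rw [interior_Icc]
        intro t ht
        obtain ⟨D, hD, -⟩ := hderiv t ⟨ht.1.le, ht.2.le.trans hT.2⟩ (hin t ⟨ht.1.le, ht.2⟩)
        exact hD.differentiableAt.differentiableWithinAt) (by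
        rw [interior_Icc]
        intro t ht
        obtain ⟨D, hD, hD'⟩ := hderiv t ⟨ht.1.le, ht.2.le.trans hT.2⟩ (hin t ⟨ht.1.le, ht.2⟩)
        rw [hD.deriv]; exact hD') 0 ⟨le_rfl, h0.le⟩ T ⟨h0.le, le_rfl⟩ h0.le
    simp only [zero_smul, add_zero, sub_zero] at key
    linarith
  have hrx : 0 < r x := by rw [hΩ] at hxΩ; exact hxΩ
  have hin : ∀ t ∈ Icc (0:ℝ) 1, x + t • v ∈ Ω := by
    by_contra! hcon
    obtain ⟨t₀, ht₀, ht₀'⟩ := hcon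
    set S := {t : ℝ | t ∈ Icc (0:ℝ) 1 ∧ x + t • v ∉ Ω} with hS
    have hScl : IsClosed S := by
      have h1 : IsClosed ((fun t : ℝ => x + t • v) ⁻¹' Ωᶜ) :=
        hO.isClosed_compl.preimage (by fun_prop)
      exact isClosed_Icc.inter h1
    have hSb : BddBelow S := ⟨0, fun t ht => ht.1.1⟩
    have hmem := hScl.csInf_mem ⟨t₀, ht₀, ht₀'⟩ hSb
    have hg := hgrow (sInf S) hmem.1 (by
      intro t ht
      by_contra hne
      have : sInf S ≤ t := csInf_le hSb ⟨⟨ht.1, ht.2.le.trans hmem.1.2⟩, hne⟩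
      linarith [ht.2])
    apply hmem.2
    rw [hΩ]
    have : 0 ≤ τ * (a / 4) * sInf S := mul_nonneg (by positivity) hmem.1.1
    show 0 < r _
    linarith
  intro t ht
  refine ⟨hin t ht, ?_⟩
  have := hgrow t ht (fun u hu => hin u ⟨hu.1, hu.2.le.trans ht.2⟩)
  linarith

lemma cone_all {ε : ℝ} (hε : 0 < ε) {Ω : Set (Euc d)} {r : Euc d → ℝ}
    (hr : IsDefiningFunction ε Ω r) {p : Euc d} (hp : p ∈ closure Ω) :
    ∃ e : Euc d, ∃ δ > (0:ℝ), ∃ ρ > (0:ℝ), ∃ c > (0:ℝ), ∀ x ∈ Ω ∩ Metric.ball p ρ,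
      ∀ v ∈ Metric.closedBall e δ, ∀ t ∈ Icc (0:ℝ) 1, x + t • v ∈ Ω ∧ c * t ≤ r (x + t • v) := by
  by_cases hpΩ : p ∈ Ω
  · obtain ⟨hO, -, -, hr0, hΩ, hC, -, -⟩ := hr
    obtain ⟨ρ, hρ, hsub⟩ := Metric.isOpen_iff.1 hO p hpΩ
    have hsub' : Metric.closedBall p (ρ / 2) ⊆ Ω :=
      (Metric.closedBall_subset_ball (by linarith)).trans hsub
    obtain ⟨z, hz, hzmin⟩ := (isCompact_closedBall p (ρ / 2)).exists_isMinOn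
      ⟨p, Metric.mem_closedBall_self (by positivity)⟩
      (hC.continuousOn.mono (hsub'.trans subset_closure))
    have hrz : 0 < r z := by
      have := hsub' hz
      rw [hΩ] at this; exact this
    refine ⟨0, ρ / 4, by positivity, ρ / 4, by positivity, r z, hrz, ?_⟩
    rintro x ⟨hx, hxp⟩ v hv t ht
    have hmem : x + t • v ∈ Metric.closedBall p (ρ / 2) := by
      rw [Metric.mem_ball, dist_eq_norm] at hxp
      rw [mem_closedBall_zero_iff] at hv
      rw [Metric.mem_closedBall, dist_eq_norm]
      calc ‖x + t • v - p‖ = ‖(x - p) + t • v‖ := by congr 1; abel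
        _ ≤ ‖x - p‖ + ‖t • v‖ := norm_add_le _ _
        _ ≤ ‖x - p‖ + 1 * ‖v‖ := by
            rw [norm_smul, Real.norm_of_nonneg ht.1]; gcongr; exact ht.2
        _ ≤ ρ / 2 := by linarith
    refine ⟨hsub' hmem, ?_⟩
    have h1 : r z ≤ r (x + t • v) := hzmin hmem
    nlinarith [ht.1, ht.2]
  · exact cone_boundary hε hr (by
      rw [hr.1.frontier_eq]; exact ⟨hp, hpΩ⟩)

/-- Lipschitz bump -/
def phiB (e : Euc d) (δ : ℝ) (v : Euc d) : ℝ := max 0 (δ - ‖v - e‖)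

lemma phiB_nonneg (e : Euc d) (δ : ℝ) (v : Euc d) : 0 ≤ phiB e δ v := le_max_left _ _

lemma phiB_cont (e : Euc d) (δ : ℝ) : Continuous (phiB e δ) := by
  unfold phiB; fun_prop

lemma phiB_le (e : Euc d) {δ : ℝ} (hδ : 0 ≤ δ) (v : Euc d) : phiB e δ v ≤ δ :=
  max_le hδ (by linarith [norm_nonneg (v - e)])

lemma phiB_zero (e : Euc d) (δ : ℝ) (v : Euc d) (hv : v ∉ Metric.closedBall e δ) :
    phiB e δ v = 0 := by
  rw [Metric.mem_closedBall, dist_eq_norm, not_le] at hv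
  exact max_eq_left (by linarith)

lemma phiB_lip (e : Euc d) (δ : ℝ) (a b : Euc d) : |phiB e δ a - phiB e δ b| ≤ ‖a - b‖ := by
  unfold phiB
  refine (abs_max_sub_max_le_max _ _ _ _).trans ?_
  have h := abs_norm_sub_norm_le (b - e) (a - e)
  have e1 : b - e - (a - e) = b - a := by abel
  have e2 : δ - ‖a - e‖ - (δ - ‖b - e‖) = ‖b - e‖ - ‖a - e‖ := by ring
  rw [e1] at h
  rw [sub_self, abs_zero, e2, norm_sub_rev a b]
  exact max_le (norm_nonneg _) h

lemma norm_le_of_mem_cb {e v : Euc d} {δ : ℝ} (hv : v ∈ Metric.closedBall e δ) :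
    ‖v‖ ≤ ‖e‖ + δ := by
  rw [Metric.mem_closedBall, dist_eq_norm] at hv
  calc ‖v‖ = ‖(v - e) + e‖ := by simp
    _ ≤ ‖v - e‖ + ‖e‖ := norm_add_le _ _
    _ ≤ _ := by linarith

/-- kernel -/
def psiB (e : Euc d) (δ : ℝ) {k : ℕ} (D : ContinuousMultilinearMap ℝ (fun _ : Fin k => Euc d) ℝ)
    (a : Euc d) : ℝ := phiB e δ a * D (fun _ => a)

lemma mult_le {k : ℕ} (D : ContinuousMultilinearMap ℝ (fun _ : Fin k => Euc d) ℝ)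
    (a : Euc d) : |D (fun _ => a)| ≤ ‖D‖ * ‖a‖ ^ k := by
  have := D.le_opNorm (fun _ => a)
  simpa using this

lemma psiB_zero (e : Euc d) (δ : ℝ) {k : ℕ}
    (D : ContinuousMultilinearMap ℝ (fun _ : Fin k => Euc d) ℝ)
    (a : Euc d) (ha : a ∉ Metric.closedBall e δ) : psiB e δ D a = 0 := by
  rw [psiB, phiB_zero _ _ _ ha, zero_mul]

lemma psiB_le (e : Euc d) {δ : ℝ} (hδ : 0 ≤ δ) {k : ℕ}
    (D : ContinuousMultilinearMap ℝ (fun _ : Fin k => Euc d) ℝ) (a : Euc d) :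
    |psiB e δ D a| ≤ (δ * (‖e‖ + δ) ^ k) * ‖D‖ := by
  by_cases ha : a ∈ Metric.closedBall e δ
  · rw [psiB, abs_mul, abs_of_nonneg (phiB_nonneg _ _ _)]
    calc phiB e δ a * |D (fun _ => a)| ≤ δ * (‖D‖ * (‖e‖ + δ) ^ k) := by
          refine mul_le_mul (phiB_le e hδ a) ((mult_le D a).trans ?_) (abs_nonneg _) hδ
          gcongr
          exact norm_le_of_mem_cb ha
      _ = _ := by ring
  · rw [psiB_zero _ _ _ _ ha]; simp; positivity

lemma psiB_lip (e : Euc d) {δ : ℝ} (hδ : 0 ≤ δ) {k : ℕ}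
    (D : ContinuousMultilinearMap ℝ (fun _ : Fin k => Euc d) ℝ) (a b : Euc d) :
    |psiB e δ D a - psiB e δ D b| ≤
      ((‖e‖ + δ) ^ k + δ * k * (‖e‖ + δ) ^ (k - 1)) * ‖D‖ * ‖a - b‖ := by
  have hX : 0 ≤ δ * k * (‖e‖ + δ) ^ (k - 1) * ‖D‖ * ‖a - b‖ := by positivity
  have main : ∀ a b : Euc d, a ∈ Metric.closedBall e δ → 
      |(phiB e δ a - phiB e δ b) * D (fun _ => a)| ≤ (‖e‖ + δ) ^ k * ‖D‖ * ‖a - b‖ := by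
    intro a b ha
    rw [abs_mul]
    calc |phiB e δ a - phiB e δ b| * |D (fun _ => a)|
        ≤ ‖a - b‖ * (‖D‖ * (‖e‖ + δ) ^ k) := by
          refine mul_le_mul (phiB_lip e δ a b) ((mult_le D a).trans ?_) (abs_nonneg _)
            (norm_nonneg _)
          gcongr
          exact norm_le_of_mem_cb ha
      _ = _ := by ring
  by_cases ha : a ∈ Metric.closedBall e δ
  · by_cases hb : b ∈ Metric.closedBall e δ
    · have h1 := main a b ha
      have h2 : |phiB e δ b * (D (fun _ => a) - D (fun _ => b))| ≤
          δ * k * (‖e‖ + δ) ^ (k - 1) * ‖D‖ * ‖a - b‖ := by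
        rw [abs_mul, abs_of_nonneg (phiB_nonneg _ _ _)]
        have h3 := D.norm_image_sub_le (fun _ => a) (fun _ => b)
        have hR : 0 ≤ ‖e‖ + δ := by positivity
        have hm1 : ‖(fun _ : Fin k => a)‖ ≤ ‖e‖ + δ :=
          (pi_norm_const_le a).trans (norm_le_of_mem_cb ha)
        have hm2 : ‖(fun _ : Fin k => b)‖ ≤ ‖e‖ + δ :=
          (pi_norm_const_le b).trans (norm_le_of_mem_cb hb)
        have hm3 : ‖(fun _ : Fin k => a) - (fun _ => b)‖ ≤ ‖a - b‖ := by
          have : (fun _ : Fin k => a) - (fun _ => b) = fun _ => a - b := rfl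
          rw [this]; exact pi_norm_const_le _
        have h4 : |D (fun _ => a) - D (fun _ => b)| ≤
            ‖D‖ * k * (‖e‖ + δ) ^ (k - 1) * ‖a - b‖ := by
          refine h3.trans ?_
          rw [Fintype.card_fin]
          gcongr
          exact max_le hm1 hm2
        calc phiB e δ b * |D (fun _ => a) - D (fun _ => b)|
            ≤ δ * (‖D‖ * k * (‖e‖ + δ) ^ (k - 1) * ‖a - b‖) :=
              mul_le_mul (phiB_le e hδ b) h4 (abs_nonneg _) hδ
          _ = _ := by ring
      have e3 : psiB e δ D a - psiB e δ D b = (phiB e δ a - phiB e δ b) * D (fun _ => a) +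
          phiB e δ b * (D (fun _ => a) - D (fun _ => b)) := by unfold psiB; ring
      rw [e3]
      refine (abs_add_le _ _).trans ?_
      nlinarith
    · have h1 := main a b ha
      rw [phiB_zero e δ b hb, sub_zero] at h1
      rw [psiB_zero _ _ _ _ hb, sub_zero, psiB]
      nlinarith
  · by_cases hb : b ∈ Metric.closedBall e δ
    · have h1 := main b a hb
      rw [phiB_zero e δ a ha, sub_zero] at h1
      rw [psiB_zero _ _ _ _ ha, zero_sub, abs_neg, psiB]
      rw [norm_sub_rev b a] at h1
      nlinarith
    · rw [psiB_zero _ _ _ _ ha, psiB_zero _ _ _ _ hb, sub_zero, abs_zero]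
      positivity

lemma taylor_cone {f : Euc d → ℝ} {x v : Euc d} {n : ℕ}
    (hf : ∀ t ∈ Icc (0:ℝ) 1, ContDiffAt ℝ (n + 1) f (x + t • v)) :
    f x = ∑ k ∈ Finset.range (n + 1), ((-1) ^ k / (k.factorial : ℝ)) *
        iteratedFDeriv ℝ k f (x + (1:ℝ) • v) (fun _ => v)
      + ((-1) ^ (n + 1) / (n.factorial : ℝ)) *
        ∫ t in (0:ℝ)..1, t ^ n * iteratedFDeriv ℝ (n + 1) f (x + t • v) (fun _ => v) := by
  have hneg : ∀ (k : ℕ) (z : Euc d), iteratedFDeriv ℝ k f z (fun _ => -v) =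
      (-1) ^ k * iteratedFDeriv ℝ k f z (fun _ => v) := by
    intro k z
    have := (iteratedFDeriv ℝ k f z).map_smul_univ (fun _ => (-1:ℝ)) (fun _ => v)
    simpa using this
  have hpt : ∀ t : ℝ, x + v + t • (-v) = x + (1 - t) • v := by
    intro t; rw [sub_smul, one_smul, smul_neg]; abel
  have key := map_add_eq_sum_add_integral_iteratedFDeriv (f := f) (x := x + v) (y := -v) (n := n)
    (by
      intro t ht
      rw [hpt]
      exact hf _ ⟨by linarith [ht.2], by linarith [ht.1]⟩)
  have e0 : x + v + -v = x := by abel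
  rw [e0] at key
  rw [key]
  congr 1
  · refine Finset.sum_congr rfl fun k _ => ?_
    rw [hneg, one_smul, smul_eq_mul]; ring
  · simp only [hneg, hpt, smul_eq_mul]
    have := intervalIntegral.integral_comp_sub_left (a := 0) (b := 1)
      (fun t : ℝ => t ^ n * ((-1) ^ (n + 1) *
        iteratedFDeriv ℝ (n + 1) f (x + t • v) (fun _ => v))) 1
    rw [this]
    simp only [sub_self, sub_zero]
    rw [div_eq_inv_mul, mul_assoc, ← intervalIntegral.integral_const_mul ((-1) ^ (n + 1))]
    congr 2
    ext t
    ring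

/-- averaged derivative -/
def avgD (f : Euc d → ℝ) (e : Euc d) (δ : ℝ) (k : ℕ) (x : Euc d) (t : ℝ) : ℝ :=
  ∫ v in Metric.closedBall e δ, psiB e δ (iteratedFDeriv ℝ k f (x + t • v)) v

lemma psi_joint_cont {Ω : Set (Euc d)} (hO : IsOpen Ω) {f : Euc d → ℝ} {s : ℕ}
    (hf : ContDiffOn ℝ s f Ω) {k : ℕ} (hk : k ≤ s) {e : Euc d} {δ : ℝ} {x : Euc d}
    (hx : ∀ v ∈ Metric.closedBall e δ, ∀ t ∈ Icc (0:ℝ) 1, x + t • v ∈ Ω) :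
    ContinuousOn (fun q : ℝ × Euc d => psiB e δ (iteratedFDeriv ℝ k f (x + q.1 • q.2)) q.2)
      (Icc (0:ℝ) 1 ×ˢ Metric.closedBall e δ) := by
  have h1 : ContinuousOn (iteratedFDeriv ℝ k f) Ω :=
    ContinuousOn.continuousOn_iteratedFDeriv hf hO (by exact_mod_cast hk)
  have h2 : ContinuousOn (fun q : ℝ × Euc d => iteratedFDeriv ℝ k f (x + q.1 • q.2))
      (Icc (0:ℝ) 1 ×ˢ Metric.closedBall e δ) :=
    h1.comp (by fun_prop) (fun q hq => hx q.2 hq.2 q.1 hq.1)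
  unfold psiB
  refine ContinuousOn.mul ((phiB_cont e δ).comp continuous_snd).continuousOn ?_
  have h3 : Continuous (fun q : (ContinuousMultilinearMap ℝ (fun _ : Fin k => Euc d) ℝ) ×
    (Fin k → Euc d) => q.1 q.2) := by fun_prop
  exact h3.comp_continuousOn (h2.prodMk (by fun_prop))

lemma avg_formula {Ω : Set (Euc d)} (hO : IsOpen Ω) {f : Euc d → ℝ} {n : ℕ}
    (hf : ContDiffOn ℝ (n + 1 : ℕ) f Ω) {e : Euc d} {δ : ℝ} {x : Euc d}
    (hx : ∀ v ∈ Metric.closedBall e δ, ∀ t ∈ Icc (0:ℝ) 1, x + t • v ∈ Ω) :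
    IntervalIntegrable (fun t => t ^ n * avgD f e δ (n + 1) x t) volume 0 1 ∧
    f x * (∫ v in Metric.closedBall e δ, phiB e δ v) =
      ∑ k ∈ Finset.range (n + 1), ((-1) ^ k / (k.factorial : ℝ)) * avgD f e δ k x 1
      + ((-1) ^ (n + 1) / (n.factorial : ℝ)) *
        ∫ t in (0:ℝ)..1, t ^ n * avgD f e δ (n + 1) x t := by
  set B := Metric.closedBall e δ with hB
  have hBc : IsCompact B := isCompact_closedBall e δ
  have hBm : MeasurableSet B := Metric.isClosed_closedBall.measurableSet
  have hjoint : IntegrableOn (fun q : ℝ × Euc d => q.1 ^ n *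
      psiB e δ (iteratedFDeriv ℝ (n + 1) f (x + q.1 • q.2)) q.2) (Icc (0:ℝ) 1 ×ˢ B)
      (volume.prod volume) := by
    have h := psi_joint_cont hO hf le_rfl hx
    exact (ContinuousOn.mul (by fun_prop) h).integrableOn_compact (isCompact_Icc.prod hBc)
  have hj2 : Integrable (fun q : ℝ × Euc d => q.1 ^ n *
      psiB e δ (iteratedFDeriv ℝ (n + 1) f (x + q.1 • q.2)) q.2)
      ((volume.restrict (Ioc (0:ℝ) 1)).prod (volume.restrict B)) := by
    rw [Measure.prod_restrict]
    exact hjoint.mono_set (prod_mono Ioc_subset_Icc_self subset_rfl)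
  have hpull : ∀ t : ℝ, t ^ n * avgD f e δ (n + 1) x t =
      ∫ v in B, t ^ n * psiB e δ (iteratedFDeriv ℝ (n + 1) f (x + t • v)) v := by
    intro t; rw [integral_const_mul]; rfl
  constructor
  · rw [intervalIntegrable_iff_integrableOn_Ioc_of_le zero_le_one]
    simp_rw [hpull]
    exact hj2.integral_prod_left
  · have hk1 : ∀ k ∈ Finset.range (n + 1), Integrable (fun v => ((-1) ^ k / (k.factorial : ℝ)) *
        psiB e δ (iteratedFDeriv ℝ k f (x + (1:ℝ) • v)) v) (volume.restrict B) := by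
      intro k hk
      have h := psi_joint_cont hO hf (Finset.mem_range.1 hk).le hx
      have h2 : ContinuousOn (fun v : Euc d => psiB e δ (iteratedFDeriv ℝ k f (x + (1:ℝ) • v)) v) B :=
        h.comp (f := fun v : Euc d => ((1:ℝ), v)) (by fun_prop)
          (fun v hv => ⟨⟨zero_le_one, le_rfl⟩, hv⟩)
      exact (h2.integrableOn_compact hBc).const_mul _
    have hpt : ∀ v ∈ B, f x * phiB e δ v =
        ∑ k ∈ Finset.range (n + 1), ((-1) ^ k / (k.factorial : ℝ)) *
          psiB e δ (iteratedFDeriv ℝ k f (x + (1:ℝ) • v)) v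
        + ((-1) ^ (n + 1) / (n.factorial : ℝ)) *
        ∫ t in Ioc (0:ℝ) 1, t ^ n * psiB e δ (iteratedFDeriv ℝ (n + 1) f (x + t • v)) v := by
      intro v hv
      have ht := taylor_cone (f := f) (x := x) (v := v) (n := n) (fun t ht => by
        have := hf.contDiffAt (hO.mem_nhds (hx v hv t ht))
        exact_mod_cast this)
      rw [intervalIntegral.integral_of_le zero_le_one] at ht
      have e1 : ∫ t in Ioc (0:ℝ) 1, t ^ n * psiB e δ (iteratedFDeriv ℝ (n + 1) f (x + t • v)) v
          = phiB e δ v * ∫ t in Ioc (0:ℝ) 1, t ^ n *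
            iteratedFDeriv ℝ (n + 1) f (x + t • v) (fun _ => v) := by
        rw [← integral_const_mul]
        refine integral_congr_ae (Filter.Eventually.of_forall fun t => ?_)
        simp only [psiB]; ring
      rw [e1]
      nth_rewrite 1 [ht]
      rw [add_mul, Finset.sum_mul]
      congr 1
      · refine Finset.sum_congr rfl fun k _ => ?_
        simp only [psiB]; ring
      · ring
    rw [← integral_const_mul, setIntegral_congr_fun hBm hpt, integral_add,
      integral_finsetSum _ hk1, integral_const_mul, intervalIntegral.integral_of_le zero_le_one]
    · congr 1
      · refine Finset.sum_congr rfl fun k _ => ?_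
        rw [integral_const_mul]; rfl
      · congr 1
        simp_rw [hpull]
        exact (integral_integral_swap (f := fun t v => t ^ n *
          psiB e δ (iteratedFDeriv ℝ (n + 1) f (x + t • v)) v) hj2).symm
    · exact integrable_finsetSum _ hk1
    · exact hj2.integral_prod_right.const_mul _

lemma int_le_sob {Ω : Set (Euc d)} {r : Euc d → ℝ} {s : ℕ} {lam : ℝ} {f : Euc d → ℝ} {k : ℕ}
    (hk : k ≤ s) :
    ∫ x in Ω, ((r x) ^ lam * ‖iteratedFDeriv ℝ k f x‖) ^ 2 ≤ sobNormSq r Ω s lam f := by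
  unfold sobNormSq
  exact Finset.single_le_sum (f := fun i => ∫ x in Ω, ((r x) ^ lam * ‖iteratedFDeriv ℝ i f x‖) ^ 2)
    (fun i _ => integral_nonneg fun x => sq_nonneg _) (Finset.mem_range.2 (by omega))

lemma l1_bound {Ω : Set (Euc d)} (hO : IsOpen Ω) {r : Euc d → ℝ}
    {f : Euc d → ℝ} {s : ℕ} {lam : ℝ} (hlam : 0 < lam) 
    (hf : ContDiffOn ℝ s f Ω) {k : ℕ} (hk : k ≤ s)
    (hint : IntegrableOn (fun x => ((r x) ^ lam * ‖iteratedFDeriv ℝ k f x‖) ^ 2) Ω)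
    {S : Set (Euc d)} (hS : IsCompact S) (hSΩ : S ⊆ Ω) {a : ℝ} (ha : 0 < a)
    (hra : ∀ w ∈ S, a ≤ r w) :
    ∫ w in S, ‖iteratedFDeriv ℝ k f w‖ ≤
      (a ^ lam)⁻¹ * Real.sqrt (volume.real S) * Real.sqrt (sobNormSq r Ω s lam f) := by
  have hSm : MeasurableSet S := hS.isClosed.measurableSet
  have hal : 0 < a ^ lam := Real.rpow_pos_of_pos ha _
  have hc : ContinuousOn (fun w => ‖iteratedFDeriv ℝ k f w‖) S :=
    (ContinuousOn.continuousOn_iteratedFDeriv hf hO (by exact_mod_cast hk)).norm.mono hSΩ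
  have : IsFiniteMeasure (volume.restrict S) := ⟨by simpa using hS.measure_lt_top⟩
  have hc2 : IntegrableOn (fun w => ‖iteratedFDeriv ℝ k f w‖ ^ 2) S :=
    (hc.pow 2).integrableOn_compact hS
  have hmem : MemLp (fun w => ‖iteratedFDeriv ℝ k f w‖) 2 (volume.restrict S) := by
    rw [memLp_two_iff_integrable_sq (hc.aestronglyMeasurable hSm)]
    exact hc2
  have hH := integral_mul_le_Lp_mul_Lq_of_nonneg (μ := volume.restrict S)
    Real.HolderConjugate.two_two (f := fun _ => (1:ℝ)) (g := fun w => ‖iteratedFDeriv ℝ k f w‖)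
    (Filter.Eventually.of_forall fun _ => zero_le_one)
    (Filter.Eventually.of_forall fun _ => norm_nonneg _)
    (memLp_const 1) (by simpa using hmem)
  simp only [one_mul, integral_const, smul_eq_mul, Real.rpow_two,
    ← Real.sqrt_eq_rpow] at hH
  rw [measureReal_restrict_apply_univ, one_pow, mul_one] at hH
  have hq : ∫ w in S, ‖iteratedFDeriv ℝ k f w‖ ^ 2 ≤ ((a ^ lam)⁻¹) ^ 2 * sobNormSq r Ω s lam f := by
    calc ∫ w in S, ‖iteratedFDeriv ℝ k f w‖ ^ 2
        ≤ ∫ w in S, ((a ^ lam)⁻¹) ^ 2 * ((r w) ^ lam * ‖iteratedFDeriv ℝ k f w‖) ^ 2 := by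
          refine setIntegral_mono_on hc2 ((hint.mono_set hSΩ).const_mul _) hSm ?_
          intro w hw
          rw [← mul_pow]
          gcongr
          have h1 : a ^ lam ≤ r w ^ lam := Real.rpow_le_rpow ha.le (hra w hw) hlam.le
          calc ‖iteratedFDeriv ℝ k f w‖ = (a ^ lam)⁻¹ * (a ^ lam * ‖iteratedFDeriv ℝ k f w‖) := by
                field_simp
            _ ≤ _ := by gcongr
      _ = ((a ^ lam)⁻¹) ^ 2 * ∫ w in S, ((r w) ^ lam * ‖iteratedFDeriv ℝ k f w‖) ^ 2 :=
          integral_const_mul _ _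
      _ ≤ ((a ^ lam)⁻¹) ^ 2 * ∫ w in Ω, ((r w) ^ lam * ‖iteratedFDeriv ℝ k f w‖) ^ 2 := by
          refine mul_le_mul_of_nonneg_left ?_ (by positivity)
          exact setIntegral_mono_set hint (Filter.Eventually.of_forall fun _ => sq_nonneg _)
            hSΩ.eventuallyLE
      _ ≤ _ := by gcongr; exact int_le_sob hk
  calc _ ≤ _ := hH
    _ ≤ Real.sqrt (volume.real S) * Real.sqrt (((a ^ lam)⁻¹) ^ 2 * sobNormSq r Ω s lam f) := by
        gcongr
    _ = _ := by
        rw [Real.sqrt_mul (sq_nonneg _), Real.sqrt_sq (by positivity)]; ring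

lemma avgD_change (f : Euc d → ℝ) (e : Euc d) (δ : ℝ) (k : ℕ) (x : Euc d) {t : ℝ} (ht : 0 < t) :
    avgD f e δ k x t = (t ^ d)⁻¹ * ∫ w, psiB e δ (iteratedFDeriv ℝ k f w) (t⁻¹ • (w - x)) := by
  unfold avgD
  rw [setIntegral_eq_integral_of_forall_compl_eq_zero (fun v hv => psiB_zero _ _ _ _ hv)]
  have h1 := Measure.integral_comp_smul (volume : Measure (Euc d))
    (fun u => psiB e δ (iteratedFDeriv ℝ k f (x + u)) (t⁻¹ • u)) t
  have h2 := integral_add_left_eq_self (μ := (volume : Measure (Euc d)))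
    (fun w => psiB e δ (iteratedFDeriv ℝ k f w) (t⁻¹ • (w - x))) x
  simp only [add_sub_cancel_left] at h2
  rw [h2, finrank_euclideanSpace_fin, abs_of_pos (by positivity), smul_eq_mul] at h1
  rw [← h1]
  refine integral_congr_ae (Filter.Eventually.of_forall fun v => ?_)
  simp only [smul_smul, inv_mul_cancel₀ ht.ne', one_smul]

lemma mem_scaled {e x w : Euc d} {δ t : ℝ} (ht : 0 < t) :
    t⁻¹ • (w - x) ∈ Metric.closedBall e δ ↔ w ∈ Metric.closedBall (x + t • e) (t * δ) := by
  rw [Metric.mem_closedBall, Metric.mem_closedBall, dist_eq_norm, dist_eq_norm]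
  have : t⁻¹ • (w - x) - e = t⁻¹ • (w - (x + t • e)) := by
    rw [← sub_sub, smul_sub _ (w - x), smul_smul, inv_mul_cancel₀ ht.ne', one_smul]
  rw [this, norm_smul, norm_inv, Real.norm_of_nonneg ht.le, inv_mul_le_iff₀ ht]

lemma scaled_sub {Ω : Set (Euc d)} {r : Euc d → ℝ} {e x : Euc d} {δ c : ℝ}
    (hx : ∀ v ∈ Metric.closedBall e δ, ∀ t ∈ Icc (0:ℝ) 1, x + t • v ∈ Ω ∧ c * t ≤ r (x + t • v))
    {t : ℝ} (ht : 0 < t) (ht1 : t ≤ 1) {w : Euc d}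
    (hw : w ∈ Metric.closedBall (x + t • e) (t * δ)) : w ∈ Ω ∧ c * t ≤ r w := by
  have h := hx _ ((mem_scaled ht).2 hw) t ⟨ht.le, ht1⟩
  rwa [smul_smul, mul_inv_cancel₀ ht.ne', one_smul, add_sub_cancel] at h

lemma kernel_integrable {Ω : Set (Euc d)} (hO : IsOpen Ω) 
    {f : Euc d → ℝ} {s : ℕ} (hf : ContDiffOn ℝ s f Ω) {k : ℕ} (hk : k ≤ s)
    {e x : Euc d} {δ : ℝ} {t : ℝ} (ht : 0 < t)
    (hS : Metric.closedBall (x + t • e) (t * δ) ⊆ Ω) :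
    Integrable (fun w => psiB e δ (iteratedFDeriv ℝ k f w) (t⁻¹ • (w - x))) := by
  have hc : ContinuousOn (iteratedFDeriv ℝ k f) (Metric.closedBall (x + t • e) (t * δ)) :=
    (ContinuousOn.continuousOn_iteratedFDeriv hf hO (by exact_mod_cast hk)).mono hS
  have hc2 : ContinuousOn (fun w => psiB e δ (iteratedFDeriv ℝ k f w) (t⁻¹ • (w - x)))
      (Metric.closedBall (x + t • e) (t * δ)) := by
    unfold psiB
    refine ContinuousOn.mul ((phiB_cont e δ).comp (by fun_prop)).continuousOn ?_
    have h3 : Continuous (fun q : (ContinuousMultilinearMap ℝ (fun _ : Fin k => Euc d) ℝ) ×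
      (Fin k → Euc d) => q.1 q.2) := by fun_prop
    exact h3.comp_continuousOn (hc.prodMk (by fun_prop))
  have hi := hc2.integrableOn_compact (μ := volume) (isCompact_closedBall _ _)
  refine (integrableOn_iff_integrable_of_support_subset ?_).1 hi
  intro w hw
  by_contra hne
  exact hw (psiB_zero _ _ _ _ (fun h => hne ((mem_scaled ht).1 h)))

/-- size of averaged derivatives; `A` is the constant -/
lemma avg_bounds {Ω : Set (Euc d)} (hO : IsOpen Ω) {r : Euc d → ℝ} {s : ℕ} {lam : ℝ}
    (hlam : 0 < lam) {e : Euc d} {δ c : ℝ} (hδ : 0 < δ) (hc : 0 < c) :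
    ∃ C > (0:ℝ), ∀ f : Euc d → ℝ, ContDiffOn ℝ s f Ω →
      (∀ i ≤ s, IntegrableOn (fun x => ((r x) ^ lam * ‖iteratedFDeriv ℝ i f x‖) ^ 2) Ω) →
      ∀ k ≤ s, ∀ x : Euc d,
      (∀ v ∈ Metric.closedBall e δ, ∀ t ∈ Icc (0:ℝ) 1, x + t • v ∈ Ω ∧ c * t ≤ r (x + t • v)) →
      ∀ t : ℝ, 0 < t → t ≤ 1 →
        |avgD f e δ k x t| ≤ C * Real.sqrt (sobNormSq r Ω s lam f) * t ^ (-(d:ℝ) / 2 - lam) ∧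
        ∀ y : Euc d,
        (∀ v ∈ Metric.closedBall e δ, ∀ t ∈ Icc (0:ℝ) 1, y + t • v ∈ Ω ∧ c * t ≤ r (y + t • v)) →
        |avgD f e δ k x t - avgD f e δ k y t| ≤
          C * Real.sqrt (sobNormSq r Ω s lam f) * t ^ (-(d:ℝ) / 2 - lam) * (dist x y / t) := by
  set R := ‖e‖ + δ + 1 with hR
  have hR1 : 1 ≤ R := by rw [hR]; linarith [norm_nonneg e]
  set P := (c ^ lam)⁻¹ * Real.sqrt (δ ^ d * volume.real (Metric.ball (0 : Euc d) 1)) with hP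
  have hP0 : 0 ≤ P := by positivity
  set M := (1 + δ + δ * s) * R ^ s with hM
  have hM0 : 0 < M := by positivity
  refine ⟨2 * M * P + 1, by positivity, ?_⟩
  intro f hf hint k hk x hx t ht ht1
  set N := Real.sqrt (sobNormSq r Ω s lam f) with hN
  have hN0 : 0 ≤ N := Real.sqrt_nonneg _
  set D := iteratedFDeriv ℝ k f with hD
  have hRk : (‖e‖ + δ) ^ k ≤ R ^ s :=
    (pow_le_pow_left₀ (by positivity) (by rw [hR]; linarith) k).trans (pow_le_pow_right₀ hR1 hk)
  have hRk1 : (‖e‖ + δ) ^ (k - 1) ≤ R ^ s :=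
    (pow_le_pow_left₀ (by positivity) (by rw [hR]; linarith) _).trans
      (pow_le_pow_right₀ hR1 (by omega))
  have hks : (k:ℝ) ≤ s := by exact_mod_cast hk
  have hM1 : δ * (‖e‖ + δ) ^ k ≤ M := by
    calc δ * (‖e‖ + δ) ^ k ≤ δ * R ^ s := by gcongr
      _ ≤ M := by
        rw [hM]; gcongr
        have : 0 ≤ δ * s := by positivity
        linarith
  have hM2 : (‖e‖ + δ) ^ k + δ * k * (‖e‖ + δ) ^ (k - 1) ≤ M := by
    calc (‖e‖ + δ) ^ k + δ * k * (‖e‖ + δ) ^ (k - 1) ≤ R ^ s + δ * s * R ^ s := by gcongr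
      _ = (1 + δ * s) * R ^ s := by ring
      _ ≤ M := by rw [hM]; gcongr; linarith
  -- the L1 bound
  have hL1 : ∀ z : Euc d,
      (∀ v ∈ Metric.closedBall e δ, ∀ t ∈ Icc (0:ℝ) 1, z + t • v ∈ Ω ∧ c * t ≤ r (z + t • v)) →
      (t ^ d)⁻¹ * ∫ w in Metric.closedBall (z + t • e) (t * δ), ‖D w‖ ≤
        P * N * t ^ (-(d:ℝ) / 2 - lam) := by
    intro z hz
    have h := l1_bound hO hlam hf hk (hint k hk) (isCompact_closedBall (z + t • e) (t * δ))
      (fun w hw => (scaled_sub hz ht ht1 hw).1) (a := c * t) (by positivity)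
      (fun w hw => (scaled_sub hz ht ht1 hw).2)
    rw [Measure.addHaar_real_closedBall _ _ (by positivity), finrank_euclideanSpace_fin, mul_pow,
      mul_assoc (t ^ d), Real.sqrt_mul (by positivity), Real.mul_rpow hc.le ht.le] at h
    calc _ ≤ (t ^ d)⁻¹ * _ := mul_le_mul_of_nonneg_left h (by positivity)
      _ = P * N * ((t ^ d)⁻¹ * Real.sqrt (t ^ d) * (t ^ lam)⁻¹) := by
          rw [hP, hN, mul_inv]; ring
      _ = _ := by
          congr 1
          rw [← Real.rpow_natCast, Real.sqrt_eq_rpow, ← Real.rpow_mul ht.le, ← Real.rpow_neg ht.le,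
            ← Real.rpow_neg ht.le, ← Real.rpow_add ht, ← Real.rpow_add ht]
          congr 1; ring
  have hDint : ∀ z : Euc d,
      (∀ v ∈ Metric.closedBall e δ, ∀ t ∈ Icc (0:ℝ) 1, z + t • v ∈ Ω ∧ c * t ≤ r (z + t • v)) →
      IntegrableOn (fun w => ‖D w‖) (Metric.closedBall (z + t • e) (t * δ)) := by
    intro z hz
    exact ((ContinuousOn.continuousOn_iteratedFDeriv hf hO
      (by exact_mod_cast hk)).norm.mono
        (fun w hw => (scaled_sub hz ht ht1 hw).1)).integrableOn_compact (isCompact_closedBall _ _)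
  have hSm : ∀ z : Euc d, MeasurableSet (Metric.closedBall (z + t • e) (t * δ)) :=
    fun z => Metric.isClosed_closedBall.measurableSet
  have htd : 0 < t ^ (-(d:ℝ) / 2 - lam) := Real.rpow_pos_of_pos ht _
  constructor
  · rw [avgD_change _ _ _ _ _ ht, abs_mul, abs_of_pos (by positivity)]
    have h1 : |∫ w, psiB e δ (D w) (t⁻¹ • (w - x))| ≤
        M * ∫ w in Metric.closedBall (x + t • e) (t * δ), ‖D w‖ := by
      rw [← integral_const_mul, ← integral_indicator (hSm x), ← Real.norm_eq_abs]
      refine norm_integral_le_of_norm_le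
        ((integrable_indicator_iff (hSm x)).2 ((hDint x hx).const_mul M)) ?_
      refine Filter.Eventually.of_forall fun w => ?_
      by_cases hw : w ∈ Metric.closedBall (x + t • e) (t * δ)
      · rw [indicator_of_mem hw, Real.norm_eq_abs]
        exact (psiB_le e hδ.le _ _).trans (by gcongr)
      · rw [indicator_of_notMem hw, psiB_zero _ _ _ _ (fun h => hw ((mem_scaled ht).1 h)), norm_zero]
    calc (t ^ d)⁻¹ * |∫ w, psiB e δ (D w) (t⁻¹ • (w - x))|
        ≤ (t ^ d)⁻¹ * (M * ∫ w in Metric.closedBall (x + t • e) (t * δ), ‖D w‖) := by gcongr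
      _ = M * ((t ^ d)⁻¹ * ∫ w in Metric.closedBall (x + t • e) (t * δ), ‖D w‖) := by ring
      _ ≤ M * (P * N * t ^ (-(d:ℝ) / 2 - lam)) := mul_le_mul_of_nonneg_left (hL1 x hx) hM0.le
      _ = (M * P) * (N * t ^ (-(d:ℝ) / 2 - lam)) := by ring
      _ ≤ (2 * M * P + 1) * (N * t ^ (-(d:ℝ) / 2 - lam)) := by
          gcongr
          have : 0 ≤ M * P := by positivity
          linarith
      _ = _ := by ring
  · intro y hy
    rw [avgD_change _ _ _ _ _ ht, avgD_change _ _ _ _ _ ht, ← mul_sub, abs_mul,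
      abs_of_pos (by positivity : 0 < (t ^ d)⁻¹),
      ← integral_sub (kernel_integrable hO hf hk ht fun w hw => (scaled_sub hx ht ht1 hw).1)
        (kernel_integrable hO hf hk ht fun w hw => (scaled_sub hy ht ht1 hw).1)]
    set L := M * (dist x y / t) with hL
    have hL0 : 0 ≤ L := by positivity
    have h1 : |∫ w, (psiB e δ (D w) (t⁻¹ • (w - x)) - psiB e δ (D w) (t⁻¹ • (w - y)))| ≤
        L * (∫ w in Metric.closedBall (x + t • e) (t * δ), ‖D w‖) +
        L * (∫ w in Metric.closedBall (y + t • e) (t * δ), ‖D w‖) := by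
      rw [← integral_const_mul, ← integral_const_mul, ← integral_indicator (hSm x),
        ← integral_indicator (hSm y), ← Real.norm_eq_abs]
      have i1 := (integrable_indicator_iff (hSm x)).2 ((hDint x hx).const_mul L)
      have i2 := (integrable_indicator_iff (hSm y)).2 ((hDint y hy).const_mul L)
      rw [← integral_add i1 i2]
      refine norm_integral_le_of_norm_le (i1.add i2) ?_
      refine Filter.Eventually.of_forall fun w => ?_
      have hdiff : |psiB e δ (D w) (t⁻¹ • (w - x)) - psiB e δ (D w) (t⁻¹ • (w - y))| ≤
          L * ‖D w‖ := by
        refine (psiB_lip e hδ.le _ _ _).trans ?_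
        have e1 : t⁻¹ • (w - x) - t⁻¹ • (w - y) = t⁻¹ • (y - x) := by
          rw [← smul_sub]; congr 1; abel
        rw [e1, norm_smul, norm_inv, Real.norm_of_nonneg ht.le, ← dist_eq_norm, dist_comm y x]
        calc _ ≤ M * ‖D w‖ * (t⁻¹ * dist x y) := by gcongr
          _ = _ := by rw [hL]; ring
      have hn : 0 ≤ L * ‖D w‖ := by positivity
      rw [Real.norm_eq_abs]
      by_cases hwx : w ∈ Metric.closedBall (x + t • e) (t * δ)
      · rw [indicator_of_mem hwx]
        have : 0 ≤ (Metric.closedBall (y + t • e) (t * δ)).indicator (fun w => L * ‖D w‖) w :=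
          indicator_nonneg (fun w _ => by positivity) w
        linarith
      · by_cases hwy : w ∈ Metric.closedBall (y + t • e) (t * δ)
        · rw [indicator_of_mem hwy, indicator_of_notMem hwx]
          linarith
        · rw [indicator_of_notMem hwy, indicator_of_notMem hwx,
            psiB_zero _ _ _ _ (fun h => hwx ((mem_scaled ht).1 h)),
            psiB_zero _ _ _ _ (fun h => hwy ((mem_scaled ht).1 h))]
          simp
    calc (t ^ d)⁻¹ * |∫ w, (psiB e δ (D w) (t⁻¹ • (w - x)) - psiB e δ (D w) (t⁻¹ • (w - y)))|
        ≤ (t ^ d)⁻¹ * (L * (∫ w in Metric.closedBall (x + t • e) (t * δ), ‖D w‖) +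
        L * (∫ w in Metric.closedBall (y + t • e) (t * δ), ‖D w‖)) := by gcongr
      _ = L * ((t ^ d)⁻¹ * ∫ w in Metric.closedBall (x + t • e) (t * δ), ‖D w‖) +
          L * ((t ^ d)⁻¹ * ∫ w in Metric.closedBall (y + t • e) (t * δ), ‖D w‖) := by ring
      _ ≤ L * (P * N * t ^ (-(d:ℝ) / 2 - lam)) + L * (P * N * t ^ (-(d:ℝ) / 2 - lam)) := 
          add_le_add (mul_le_mul_of_nonneg_left (hL1 x hx) hL0)
            (mul_le_mul_of_nonneg_left (hL1 y hy) hL0)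
      _ = (2 * M * P) * (N * t ^ (-(d:ℝ) / 2 - lam) * (dist x y / t)) := by rw [hL]; ring
      _ ≤ (2 * M * P + 1) * (N * t ^ (-(d:ℝ) / 2 - lam) * (dist x y / t)) := by
          gcongr; linarith
      _ = _ := by ring

lemma phiB_int_pos (e : Euc d) {δ : ℝ} (hδ : 0 < δ) :
    0 < ∫ v in Metric.closedBall e δ, phiB e δ v := by
  have hi : IntegrableOn (phiB e δ) (Metric.closedBall e δ) :=
    (phiB_cont e δ).continuousOn.integrableOn_compact (isCompact_closedBall _ _)
  rw [setIntegral_pos_iff_support_of_nonneg_ae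
    (Filter.Eventually.of_forall fun v => phiB_nonneg e δ v) hi]
  refine lt_of_lt_of_le (Metric.measure_ball_pos volume e hδ) (measure_mono ?_)
  intro v hv
  refine ⟨?_, Metric.ball_subset_closedBall hv⟩
  rw [Metric.mem_ball, dist_eq_norm] at hv
  have : 0 < phiB e δ v := lt_max_of_lt_right (by linarith)
  exact this.ne'

lemma local_est {Ω : Set (Euc d)} (hO : IsOpen Ω) {r : Euc d → ℝ} {s : ℕ} (hs : 1 ≤ s) {lam : ℝ}
    (hlam : 0 < lam) {γ : ℝ} (hγ₀ : 0 < γ) (hγ₁ : γ < 1) (hγ₂ : γ ≤ (s : ℝ) - lam - d / 2)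
    {U : Set (Euc d)} {e : Euc d} {δ c : ℝ} (hδ : 0 < δ) (hc : 0 < c)
    (hU : ∀ x ∈ U, ∀ v ∈ Metric.closedBall e δ, ∀ t ∈ Icc (0:ℝ) 1,
      x + t • v ∈ Ω ∧ c * t ≤ r (x + t • v)) :
    ∃ C > (0:ℝ), ∀ f : Euc d → ℝ, ContDiffOn ℝ s f Ω →
      (∀ i ≤ s, IntegrableOn (fun x => ((r x) ^ lam * ‖iteratedFDeriv ℝ i f x‖) ^ 2) Ω) →
      (∀ x ∈ U, |f x| ≤ C * Real.sqrt (sobNormSq r Ω s lam f)) ∧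
      (∀ x ∈ U, ∀ y ∈ U,
        |f x - f y| ≤ C * Real.sqrt (sobNormSq r Ω s lam f) * dist x y ^ γ) := by
  obtain ⟨n, rfl⟩ : ∃ n, s = n + 1 := ⟨s - 1, by omega⟩
  obtain ⟨C₀, hC₀, hb⟩ := avg_bounds hO (r := r) (s := n + 1) hlam (e := e) hδ hc
  set m := ∫ v in Metric.closedBall e δ, phiB e δ v with hm
  have hm0 : 0 < m := phiB_int_pos e hδ
  have h1γ : 0 < 1 - γ := by linarith
  set K₁ : ℝ := (n + 1) + 1 / γ with hK₁
  set K₂ : ℝ := (n + 1) + 2 / γ + 1 / (1 - γ) with hK₂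
  have hK₁0 : 0 < K₁ := by positivity
  have hK₂0 : 0 < K₂ := by positivity
  refine ⟨C₀ / m * (2 * K₁ + K₂), by positivity, ?_⟩
  intro f hf hint
  set N := Real.sqrt (sobNormSq r Ω (n + 1) lam f) with hN
  have hN0 : 0 ≤ N := Real.sqrt_nonneg _
  have hb' := hb f hf hint
  have hck : ∀ k : ℕ, |(-1) ^ k / (k.factorial : ℝ)| ≤ 1 := by
    intro k
    rw [abs_div, abs_pow, abs_neg, abs_one, one_pow, Nat.abs_cast]
    have : (1:ℝ) ≤ k.factorial := by exact_mod_cast Nat.one_le_iff_ne_zero.2 k.factorial_ne_zero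
    exact div_le_one_of_le₀ this (by positivity)
  have hck' : |(-1) ^ (n + 1) / (n.factorial : ℝ)| ≤ 1 := by
    rw [abs_div, abs_pow, abs_neg, abs_one, one_pow, Nat.abs_cast]
    have : (1:ℝ) ≤ n.factorial := by exact_mod_cast Nat.one_le_iff_ne_zero.2 n.factorial_ne_zero
    exact div_le_one_of_le₀ this (by positivity)
  have hpow : ∀ t : ℝ, 0 < t → t ≤ 1 → t ^ n * t ^ (-(d:ℝ) / 2 - lam) ≤ t ^ (γ - 1) := by
    intro t ht ht1
    rw [← Real.rpow_natCast, ← Real.rpow_add ht]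
    refine Real.rpow_le_rpow_of_exponent_ge ht ht1 ?_
    push_cast at hγ₂
    linarith
  have hrem : ∀ x ∈ U, ∀ t : ℝ, 0 < t → t ≤ 1 →
      ‖t ^ n * avgD f e δ (n + 1) x t‖ ≤ C₀ * N * t ^ (γ - 1) := by
    intro x hx t ht ht1
    have h := (hb' (n + 1) le_rfl x (hU x hx) t ht ht1).1
    rw [Real.norm_eq_abs, abs_mul, abs_of_pos (pow_pos ht n)]
    calc _ ≤ t ^ n * (C₀ * N * t ^ (-(d:ℝ) / 2 - lam)) :=
          mul_le_mul_of_nonneg_left h (pow_pos ht n).le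
      _ = C₀ * N * (t ^ n * t ^ (-(d:ℝ) / 2 - lam)) := by ring
      _ ≤ _ := mul_le_mul_of_nonneg_left (hpow t ht ht1) (by positivity)
  have hrpint : ∀ h : ℝ, IntervalIntegrable (fun t : ℝ => t ^ (γ - 1)) volume 0 h :=
    fun h => intervalIntegral.intervalIntegrable_rpow' (by linarith)
  have hrpval : ∀ h : ℝ, ∫ t in (0:ℝ)..h, t ^ (γ - 1) = h ^ γ / γ := by
    intro h
    rw [integral_rpow (Or.inl (by linarith))]
    simp [Real.zero_rpow hγ₀.ne']
  have havg : ∀ x ∈ U, _ := fun x hx => avg_formula hO hf (e := e) (δ := δ) (x := x)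
    (fun v hv t ht => (hU x hx v hv t ht).1)
  have hsup : ∀ x ∈ U, |f x| ≤ C₀ / m * K₁ * N := by
    intro x hx
    obtain ⟨hi, hform⟩ := havg x hx
    have h1 : |∑ k ∈ Finset.range (n + 1), ((-1) ^ k / (k.factorial : ℝ)) * avgD f e δ k x 1| ≤
        (n + 1) * (C₀ * N) := by
      refine (Finset.abs_sum_le_sum_abs _ _).trans ?_
      calc _ ≤ ∑ k ∈ Finset.range (n + 1), C₀ * N := by
            refine Finset.sum_le_sum fun k hk => ?_
            have h := (hb' k (Finset.mem_range.1 hk).le x (hU x hx) 1 one_pos le_rfl).1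
            rw [Real.one_rpow, mul_one] at h
            rw [abs_mul]
            calc _ ≤ 1 * (C₀ * N) := mul_le_mul (hck k) h (abs_nonneg _) zero_le_one
              _ = _ := one_mul _
        _ = _ := by simp
    have h2 : |∫ t in (0:ℝ)..1, t ^ n * avgD f e δ (n + 1) x t| ≤ C₀ * N * (1 / γ) := by
      have := intervalIntegral.norm_integral_le_of_norm_le zero_le_one
        (f := fun t => t ^ n * avgD f e δ (n + 1) x t) (g := fun t => C₀ * N * t ^ (γ - 1))
        (μ := volume)
        (Filter.Eventually.of_forall fun t ht => hrem x hx t ht.1 ht.2) ((hrpint 1).const_mul _)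
      rwa [intervalIntegral.integral_const_mul, hrpval, Real.one_rpow] at this
    have h3 : |f x| * m ≤ C₀ * K₁ * N := by
      rw [← abs_of_pos hm0, ← abs_mul, hm, hform]
      refine (abs_add_le _ _).trans ?_
      rw [abs_mul ((-1) ^ (n + 1) / (n.factorial : ℝ))]
      calc _ ≤ (n + 1) * (C₀ * N) + 1 * (C₀ * N * (1 / γ)) :=
            add_le_add h1 (mul_le_mul hck' h2 (abs_nonneg _) zero_le_one)
        _ = _ := by rw [hK₁]; ring
    calc |f x| = |f x| * m / m := by field_simp
      _ ≤ C₀ * K₁ * N / m := by gcongr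
      _ = _ := by ring
  refine ⟨fun x hx => (hsup x hx).trans ?_, ?_⟩
  · gcongr ?_ * N
    gcongr
    linarith
  intro x hx y hy
  set h := dist x y with hh
  rcases (dist_nonneg : 0 ≤ dist x y).eq_or_lt with h0 | h0
  · have : x = y := dist_eq_zero.1 h0.symm
    rw [this, sub_self, abs_zero]
    positivity
  rcases le_or_gt 1 h with hh1 | hh1
  · have hγh : 1 ≤ h ^ γ := Real.one_le_rpow hh1 hγ₀.le
    calc |f x - f y| ≤ |f x| + |f y| := abs_sub _ _
      _ ≤ C₀ / m * K₁ * N + C₀ / m * K₁ * N := add_le_add (hsup x hx) (hsup y hy)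
      _ = C₀ / m * (2 * K₁) * N * 1 := by ring
      _ ≤ C₀ / m * (2 * K₁ + K₂) * N * h ^ γ := by
          gcongr
          linarith
  · have hhγ : h ≤ h ^ γ := by
      calc h = h ^ (1:ℝ) := (Real.rpow_one h).symm
        _ ≤ h ^ γ := Real.rpow_le_rpow_of_exponent_ge h0 hh1.le hγ₁.le
    obtain ⟨hix, hfx⟩ := havg x hx
    obtain ⟨hiy, hfy⟩ := havg y hy
    have h1 : |∑ k ∈ Finset.range (n + 1), (((-1) ^ k / (k.factorial : ℝ)) * avgD f e δ k x 1 -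
        ((-1) ^ k / (k.factorial : ℝ)) * avgD f e δ k y 1)| ≤ (n + 1) * (C₀ * N * h ^ γ) := by
      refine (Finset.abs_sum_le_sum_abs _ _).trans ?_
      calc _ ≤ ∑ k ∈ Finset.range (n + 1), C₀ * N * h ^ γ := by
            refine Finset.sum_le_sum fun k hk => ?_
            have h := (hb' k (Finset.mem_range.1 hk).le x (hU x hx) 1 one_pos le_rfl).2 y (hU y hy)
            rw [Real.one_rpow, mul_one, div_one] at h
            rw [← mul_sub, abs_mul]
            calc _ ≤ 1 * (C₀ * N * dist x y) := mul_le_mul (hck k) h (abs_nonneg _) zero_le_one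
              _ = C₀ * N * dist x y := one_mul _
              _ ≤ _ := mul_le_mul_of_nonneg_left hhγ (by positivity)
        _ = _ := by simp
    set g : ℝ → ℝ := fun t => t ^ n * avgD f e δ (n + 1) x t - t ^ n * avgD f e δ (n + 1) y t with hg
    have hgi : IntervalIntegrable g volume 0 1 := hix.sub hiy
    have hgi1 : IntervalIntegrable g volume 0 h := hgi.mono_set (by
      rw [uIcc_of_le h0.le, uIcc_of_le zero_le_one]; exact Icc_subset_Icc le_rfl hh1.le)
    have hgi2 : IntervalIntegrable g volume h 1 := hgi.mono_set (by
      rw [uIcc_of_le hh1.le, uIcc_of_le zero_le_one]; exact Icc_subset_Icc h0.le le_rfl)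
    have h2 : |∫ t in (0:ℝ)..h, g t| ≤ C₀ * N * (2 / γ) * h ^ γ := by
      have := intervalIntegral.norm_integral_le_of_norm_le h0.le
        (f := g) (g := fun t => 2 * (C₀ * N) * t ^ (γ - 1))
        (μ := volume)
        (Filter.Eventually.of_forall fun t ht => by
          have a1 := hrem x hx t ht.1 (ht.2.trans hh1.le)
          have a2 := hrem y hy t ht.1 (ht.2.trans hh1.le)
          refine (norm_sub_le _ _).trans ?_
          linarith) ((hrpint h).const_mul _)
      rw [intervalIntegral.integral_const_mul, hrpval] at this
      refine this.trans (le_of_eq ?_)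
      ring
    have hnot : (0:ℝ) ∉ uIcc h 1 := by
      rw [uIcc_of_le hh1.le]; intro h'; exact absurd h'.1 (not_le.2 h0)
    have h3 : |∫ t in h..1, g t| ≤ C₀ * N * (1 / (1 - γ)) * h ^ γ := by
      have := intervalIntegral.norm_integral_le_of_norm_le hh1.le
        (f := g) (g := fun t => (C₀ * N * h) * t ^ (γ - 2))
        (μ := volume)
        (Filter.Eventually.of_forall fun t ht => by
          have ht0 : 0 < t := h0.trans ht.1
          have a1 := (hb' (n + 1) le_rfl x (hU x hx) t ht0 ht.2).2 y (hU y hy)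
          rw [hg]
          simp only
          rw [← mul_sub, Real.norm_eq_abs, abs_mul, abs_of_pos (pow_pos ht0 n)]
          calc _ ≤ t ^ n * (C₀ * N * t ^ (-(d:ℝ) / 2 - lam) * (h / t)) :=
                mul_le_mul_of_nonneg_left a1 (pow_pos ht0 n).le
            _ = C₀ * N * (h / t) * (t ^ n * t ^ (-(d:ℝ) / 2 - lam)) := by ring
            _ ≤ C₀ * N * (h / t) * t ^ (γ - 1) :=
                mul_le_mul_of_nonneg_left (hpow t ht0 ht.2) (by positivity)
            _ = _ := by
                have : γ - 2 = (γ - 1) - 1 := by ring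
                rw [this, Real.rpow_sub_one ht0.ne' (γ - 1)]
                ring)
        ((intervalIntegral.intervalIntegrable_rpow (Or.inr hnot)).const_mul _)
      rw [intervalIntegral.integral_const_mul,
        integral_rpow (Or.inr ⟨by linarith, hnot⟩), Real.one_rpow] at this
      refine this.trans ?_
      have e1 : γ - 2 + 1 = γ - 1 := by ring
      have e2 : (1 - h ^ (γ - 1)) / (γ - 1) = (h ^ (γ - 1) - 1) / (1 - γ) := by
        rw [← neg_sub (h ^ (γ - 1)) 1, ← neg_sub 1 γ, neg_div_neg_eq]
      rw [e1, e2]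
      have e3 : h * h ^ (γ - 1) = h ^ γ := by
        rw [Real.rpow_sub_one h0.ne']; exact mul_div_cancel₀ _ h0.ne'
      calc C₀ * N * h * ((h ^ (γ - 1) - 1) / (1 - γ))
          ≤ C₀ * N * h * (h ^ (γ - 1) / (1 - γ)) := by gcongr; linarith
        _ = C₀ * N * (1 / (1 - γ)) * (h * h ^ (γ - 1)) := by ring
        _ = _ := by rw [e3]
    have h4 : |f x - f y| * m ≤ C₀ * K₂ * N * h ^ γ := by
      rw [← abs_of_pos hm0, ← abs_mul, sub_mul, hm, hfx, hfy]
      have e1 : ∀ a b a' b' q : ℝ, a + q * b - (a' + q * b') = (a - a') + q * (b - b') := by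
        intros; ring
      rw [e1, ← Finset.sum_sub_distrib, ← intervalIntegral.integral_sub hix hiy,
        ← intervalIntegral.integral_add_adjacent_intervals hgi1 hgi2]
      refine (abs_add_le _ _).trans ?_
      rw [abs_mul ((-1) ^ (n + 1) / (n.factorial : ℝ))]
      have h5 : |(∫ t in (0:ℝ)..h, g t) + ∫ t in h..1, g t| ≤
          C₀ * N * (2 / γ) * h ^ γ + C₀ * N * (1 / (1 - γ)) * h ^ γ :=
        (abs_add_le _ _).trans (add_le_add h2 h3)
      calc _ ≤ (n + 1) * (C₀ * N * h ^ γ) +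
            1 * (C₀ * N * (2 / γ) * h ^ γ + C₀ * N * (1 / (1 - γ)) * h ^ γ) :=
            add_le_add h1 (mul_le_mul hck' h5 (abs_nonneg _) zero_le_one)
        _ = _ := by rw [hK₂]; ring
    calc |f x - f y| = |f x - f y| * m / m := by field_simp
      _ ≤ C₀ * K₂ * N * h ^ γ / m := by gcongr
      _ = C₀ / m * K₂ * N * h ^ γ := by ring
      _ ≤ C₀ / m * (2 * K₁ + K₂) * N * h ^ γ := by gcongr; linarith

/-- **Morrey-type embedding for weighted Sobolev spaces** (Corollary 2.4):
for `0 < λ ≤ s` with `s − λ − d/2 > 0` and `0 < γ < 1` with `γ ≤ s − λ − d/2`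
(equality being allowed only when `s − λ − d/2` is not an integer), one has
`‖f‖_{C^γ(Ω)} ≤ C‖f‖_{H^{s,λ}_r(Ω)}`. -/
theorem morrey_type_embedding
    {d : ℕ} (hd : 1 ≤ d) {ε : ℝ} (hε : 0 < ε)
    (Ω : Set (Euc d)) (r : Euc d → ℝ) (hr : IsDefiningFunction ε Ω r)
    (s : ℕ) (hs : 1 ≤ s) (lam : ℝ) (hlam₀ : 0 < lam) (hlam₁ : lam ≤ s)
    (hsub : 0 < (s : ℝ) - lam - d / 2)
    (γ : ℝ) (hγ₀ : 0 < γ) (hγ₁ : γ < 1) (hγ₂ : γ ≤ (s : ℝ) - lam - d / 2)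
    (hγ₃ : γ = (s : ℝ) - lam - d / 2 → ∀ n : ℤ, (s : ℝ) - lam - d / 2 ≠ n) :
    ∃ C > (0:ℝ), ∀ f : Euc d → ℝ, ContDiffOn ℝ s f Ω →
      (∀ i ≤ s, IntegrableOn (fun x => ((r x) ^ lam * ‖iteratedFDeriv ℝ i f x‖) ^ 2) Ω) →
      (∀ x ∈ Ω, |f x| ≤ C * Real.sqrt (sobNormSq r Ω s lam f)) ∧
      (∀ x ∈ Ω, ∀ y ∈ Ω,
        |f x - f y| ≤ C * Real.sqrt (sobNormSq r Ω s lam f) * dist x y ^ γ) := by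
  have hO : IsOpen Ω := hr.1
  have hK : IsCompact (closure Ω) := hr.2.2.1.isCompact_closure
  have hloc : ∀ p : closure Ω, ∃ ρ > (0:ℝ), ∃ C > (0:ℝ), ∀ f : Euc d → ℝ, ContDiffOn ℝ s f Ω →
      (∀ i ≤ s, IntegrableOn (fun x => ((r x) ^ lam * ‖iteratedFDeriv ℝ i f x‖) ^ 2) Ω) →
      (∀ x ∈ Ω ∩ Metric.ball p.1 ρ, |f x| ≤ C * Real.sqrt (sobNormSq r Ω s lam f)) ∧
      (∀ x ∈ Ω ∩ Metric.ball p.1 ρ, ∀ y ∈ Ω ∩ Metric.ball p.1 ρ,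
        |f x - f y| ≤ C * Real.sqrt (sobNormSq r Ω s lam f) * dist x y ^ γ) := by
    intro p
    obtain ⟨e, δ, hδ, ρ, hρ, c, hc, hcone⟩ := cone_all hε hr p.2
    exact ⟨ρ, hρ, local_est hO hs hlam₀ hγ₀ hγ₁ hγ₂ hδ hc hcone⟩
  choose ρ hρ C hC hest using hloc
  obtain ⟨T, hT⟩ := hK.elim_finite_subcover (fun p : closure Ω => Metric.ball p.1 (ρ p))
    (fun p => Metric.isOpen_ball)
    (fun x hx => mem_iUnion.2 ⟨⟨x, hx⟩, Metric.mem_ball_self (hρ _)⟩)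
  obtain ⟨η, hη, hleb⟩ := lebesgue_number_lemma_of_metric (s := closure Ω)
    (c := fun p : T => Metric.ball p.1.1 (ρ p.1)) hK (fun p => Metric.isOpen_ball)
    (by
      intro x hx
      obtain ⟨p, hp, hxp⟩ := mem_iUnion₂.1 (hT hx)
      exact mem_iUnion.2 ⟨⟨p, hp⟩, hxp⟩)
  set M := ∑ p ∈ T, C p with hM
  have hMC : ∀ p ∈ T, C p ≤ M := fun p hp =>
    Finset.single_le_sum (f := C) (fun q _ => (hC q).le) hp
  have hM0 : 0 ≤ M := Finset.sum_nonneg fun q _ => (hC q).le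
  have hηγ : 0 < η ^ γ := Real.rpow_pos_of_pos hη _
  refine ⟨M + 2 * M / η ^ γ + 1, by positivity, ?_⟩
  intro f hf hint
  set N := Real.sqrt (sobNormSq r Ω s lam f) with hN
  have hN0 : 0 ≤ N := Real.sqrt_nonneg _
  have hsup : ∀ x ∈ Ω, |f x| ≤ M * N := by
    intro x hx
    obtain ⟨p, hp, hxp⟩ := mem_iUnion₂.1 (hT (subset_closure hx))
    exact ((hest p f hf hint).1 x ⟨hx, hxp⟩).trans
      (mul_le_mul_of_nonneg_right (hMC p hp) hN0)
  have hq : 0 ≤ 2 * M / η ^ γ := by positivity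
  refine ⟨fun x hx => (hsup x hx).trans (mul_le_mul_of_nonneg_right (by linarith) hN0), ?_⟩
  intro x hx y hy
  have hdγ : 0 ≤ dist x y ^ γ := Real.rpow_nonneg dist_nonneg _
  rcases lt_or_ge (dist x y) η with hlt | hge
  · obtain ⟨p, hp⟩ := hleb x (subset_closure hx)
    refine ((hest p.1 f hf hint).2 x ⟨hx, hp (Metric.mem_ball_self hη)⟩ y
      ⟨hy, hp (by rwa [Metric.mem_ball, dist_comm])⟩).trans ?_
    have := hMC p.1 p.2
    gcongr
    linarith
  · calc |f x - f y| ≤ |f x| + |f y| := abs_sub _ _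
      _ ≤ M * N + M * N := add_le_add (hsup x hx) (hsup y hy)
      _ = 2 * M / η ^ γ * N * η ^ γ := by field_simp; ring
      _ ≤ (M + 2 * M / η ^ γ + 1) * N * dist x y ^ γ := by
          gcongr
          linarith
end
end
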